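/- Let n ≥ 4 and N ≥ 2n, and fix μ ∈ {−1, 1}. There exists ε₀ > 0, depending only on n and N, with the following property: let 0 < ε ≤ ε₀ and let f : [0,T) × ℝⁿ_x × ℝⁿ_v → ℝ be a smooth solution of the Vlasov–Poisson system ∂_t f + v·∇ₓ f + μ ∇ₓφ·∇ᵥ f = 0 with potential φ(t,x) = ∫_{ℝⁿ} G₀(x−y) ρ(f)(t,y) dy, such that f(t,·,·) is compactly supported in (x,v) for each t, the function t ↦ 𝓔_N[f(t)] is continuous, and 𝓔_N[f(0)] ≤ ε. Then 𝓔_N[f(t)] ≤ 2ε for all t ∈ [0,T). -/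

import Mathlib

noncomputable section

open MeasureTheory Real

/-- `E n` is the Euclidean space `ℝⁿ`. -/
abbrev E (n : ℕ) : Type := EuclideanSpace ℝ (Fin n)

/-- Index set for the commuting vector fields: spatial translations `∂_{xⁱ}`,
uniform motions `t∂_{xⁱ} + ∂_{vⁱ}` (macroscopically `t∂_{xⁱ}`),
rotations `Ωˣᵢⱼ + Ωᵛᵢⱼ` for `i < j` (macroscopically `Ωˣᵢⱼ`),
and the scaling `Sˣ + Sᵛ` (macroscopically `Sˣ`). -/
abbrev VFIdx (n : ℕ) : Type := Fin n ⊕ Fin n ⊕ {p : Fin n × Fin n // p.1 < p.2} ⊕ Unit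

variable {n : ℕ}

/-- Partial derivative of `g : ℝⁿ → ℝ` at `x` in the `i`-th coordinate direction. -/
def pd (i : Fin n) (g : E n → ℝ) (x : E n) : ℝ :=
  fderiv ℝ g x (EuclideanSpace.single i 1)

/-- Iterated coordinate partial derivatives `∂ₓ^α`. -/
def pdList (ds : List (Fin n)) (g : E n → ℝ) : E n → ℝ :=
  ds.foldr (fun i h => pd i h) g

/-- The action of a microscopic vector field of the family `γ`
on a function `f(t,x,v)`. -/
def microApply (Z : VFIdx n) (f : ℝ → E n → E n → ℝ) : ℝ → E n → E n → ℝ :=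
  fun t x v =>
    match Z with
    | Sum.inl i => pd i (fun y => f t y v) x
    | Sum.inr (Sum.inl i) => t * pd i (fun y => f t y v) x + pd i (fun w => f t x w) v
    | Sum.inr (Sum.inr (Sum.inl p)) =>
        x p.1.1 * pd p.1.2 (fun y => f t y v) x - x p.1.2 * pd p.1.1 (fun y => f t y v) x
          + v p.1.1 * pd p.1.2 (fun w => f t x w) v - v p.1.2 * pd p.1.1 (fun w => f t x w) v
    | Sum.inr (Sum.inr (Sum.inr _)) =>
        (∑ i, x i * pd i (fun y => f t y v) x) + ∑ i, v i * pd i (fun w => f t x w) v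

/-- The action of a macroscopic vector field of the family `Γ`
on a function `φ(t,x)`. -/
def macroApply (Z : VFIdx n) (φ : ℝ → E n → ℝ) : ℝ → E n → ℝ :=
  fun t x =>
    match Z with
    | Sum.inl i => pd i (φ t) x
    | Sum.inr (Sum.inl i) => t * pd i (φ t) x
    | Sum.inr (Sum.inr (Sum.inl p)) =>
        x p.1.1 * pd p.1.2 (φ t) x - x p.1.2 * pd p.1.1 (φ t) x
    | Sum.inr (Sum.inr (Sum.inr _)) => ∑ i, x i * pd i (φ t) x

/-- Composition `Z^α = Z^{α₁} ⋯ Z^{α_k}` of microscopic vector fields. -/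
def microList (L : List (VFIdx n)) (f : ℝ → E n → E n → ℝ) : ℝ → E n → E n → ℝ :=
  L.foldr microApply f

/-- Composition `Z^α = Z^{α₁} ⋯ Z^{α_k}` of macroscopic vector fields. -/
def macroList (L : List (VFIdx n)) (φ : ℝ → E n → ℝ) : ℝ → E n → ℝ :=
  L.foldr macroApply φ

/-- Velocity average `ρ(f)(t,x) = ∫ f(t,x,v) dv`. -/
def rho (f : ℝ → E n → E n → ℝ) (t : ℝ) (x : E n) : ℝ := ∫ v : E n, f t x v

/-- The spatial Laplacian. -/
def lap (g : E n → ℝ) (x : E n) : ℝ := ∑ i, pd i (fun y => pd i g y) x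

/-- The free transport operator `T(f) = ∂_t f + v·∇ₓ f`. -/
def Tfree (f : ℝ → E n → E n → ℝ) : ℝ → E n → E n → ℝ :=
  fun t x v => deriv (fun s => f s x v) t + ∑ i, v i * pd i (fun y => f t y v) x

/-- The perturbed transport operator `T_φ(f) = ∂_t f + v·∇ₓ f + μ ∇ₓφ·∇ᵥ f`. -/
def Tphi (μ : ℝ) (φ : ℝ → E n → ℝ) (f : ℝ → E n → E n → ℝ) : ℝ → E n → E n → ℝ :=
  fun t x v => Tfree f t x v + μ * ∑ i, pd i (φ t) x * pd i (fun w => f t x w) v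

/-- The energy `𝓔_N[f](t) = Σ_{|α| ≤ N} ‖Z^α f‖_{L¹(ℝⁿ_x × ℝⁿ_v)}`. -/
def energy (n N : ℕ) (f : ℝ → E n → E n → ℝ) (t : ℝ) : ℝ :=
  ∑ m ∈ Finset.range (N + 1), ∑ α : Fin m → VFIdx n,
    ∫ x : E n, ∫ v : E n, |microList (List.ofFn α) f t x v|

/-- Smoothness of a function of `(t,x,v)`. -/
def SmoothTXV (n : ℕ) (f : ℝ → E n → E n → ℝ) : Prop :=
  ContDiff ℝ (⊤ : ℕ∞) (fun p : ℝ × E n × E n => f p.1 p.2.1 p.2.2)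

/-- Smoothness of a function of `(t,x)`. -/
def SmoothTX (n : ℕ) (φ : ℝ → E n → ℝ) : Prop :=
  ContDiff ℝ (⊤ : ℕ∞) (fun p : ℝ × E n => φ p.1 p.2)

/-- The modified Bessel function of the second kind `K_ν(r)`. -/
def Kfun (ν r : ℝ) : ℝ :=
  ∫ l in Set.Ioi (0 : ℝ), Real.exp (-(r * Real.cosh l)) * Real.cosh (ν * l)

/-- The Yukawa Green's function `G₁(x) = c |x|^{1-n/2} K_{n/2-1}(|x|)`. -/
def Gyukawa (n : ℕ) (c : ℝ) (x : E n) : ℝ :=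
  c * ‖x‖ ^ ((1 : ℝ) - (n : ℝ) / 2) * Kfun ((n : ℝ) / 2 - 1) ‖x‖

/-- Convolution of two scalar functions on `ℝⁿ`. -/
def conv (g h : E n → ℝ) (x : E n) : ℝ := ∫ y : E n, g (x - y) * h y

/-- `k`-fold convolution with `g` (the `0`-fold one being the identity). -/
def convIter (g : E n → ℝ) : ℕ → (E n → ℝ) → E n → ℝ
  | 0, h => h
  | m + 1, h => conv g (convIter g m h)


set_option linter.all false

namespace VP
open scoped ContDiff

/-- Phase space. -/
abbrev V (n : ℕ) : Type := E n × E n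

/-- Linear part of the vector field. -/
def vA : VFIdx n → (E n →L[ℝ] E n)
  | Sum.inl _ => 0
  | Sum.inr (Sum.inl _) => 0
  | Sum.inr (Sum.inr (Sum.inl p)) =>
      (EuclideanSpace.proj p.1.1 : E n →L[ℝ] ℝ).smulRight (EuclideanSpace.single p.1.2 (1 : ℝ))
      - (EuclideanSpace.proj p.1.2 : E n →L[ℝ] ℝ).smulRight (EuclideanSpace.single p.1.1 (1 : ℝ))
  | Sum.inr (Sum.inr (Sum.inr _)) => ContinuousLinearMap.id ℝ (E n)

def va : VFIdx n → E n
  | Sum.inl i => EuclideanSpace.single i 1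
  | _ => 0

def vb : VFIdx n → E n
  | Sum.inr (Sum.inl i) => EuclideanSpace.single i 1
  | _ => 0

def vc : VFIdx n → ℝ
  | Sum.inr (Sum.inr (Sum.inr _)) => 1
  | _ => 0

/-- `A` acting diagonally on phase space. -/
def AA (Z : VFIdx n) : V n →L[ℝ] V n := (vA Z).prodMap (vA Z)

/-- The vector field at time `t`. -/
def X (Z : VFIdx n) (t : ℝ) (p : V n) : V n := (va Z + t • vb Z, vb Z) + AA Z p

lemma vA_symm (Z : VFIdx n) (i j : Fin n) :
    vA Z (EuclideanSpace.single i 1) j + vA Z (EuclideanSpace.single j 1) i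
      = 2 * vc Z * (if i = j then 1 else 0) := by
  rcases Z with k | k | ⟨⟨k, l⟩, hkl⟩ | u
  · simp [vA, vc]
  · simp [vA, vc]
  · simp only [vA, vc]
    simp only [sub_apply, ContinuousLinearMap.smulRight_apply, PiLp.sub_apply, PiLp.smul_apply,
      smul_eq_mul]
    simp only [EuclideanSpace.proj, PiLp.proj_apply, EuclideanSpace.single, PiLp.single_apply]
    simp only [@eq_comm _ k, @eq_comm _ l]
    ring
  · simp only [vA, vc, ContinuousLinearMap.id_apply]
    simp [@eq_comm _ j i]
    split_ifs <;> norm_num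

lemma vA_inner (Z : VFIdx n) (x : E n) : inner ℝ x (vA Z x) = vc Z * ‖x‖ ^ 2 := by
  rcases Z with k | k | ⟨⟨k, l⟩, hkl⟩ | u
  · simp [vA, vc]
  · simp [vA, vc]
  · simp only [vA, vc]
    simp [inner_sub_right, inner_smul_right, EuclideanSpace.inner_single_right]; ring
  · simp [vA, vc]

lemma vA_trace (Z : VFIdx n) : ∑ i, vA Z (EuclideanSpace.single i 1) i = n * vc Z := by
  have h : ∀ i, vA Z (EuclideanSpace.single i 1) i = vc Z := by
    intro i
    have := vA_symm Z i i
    simp at this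
    linarith
  simp [h]

/-- Action of a vector field on a function on phase space. -/
def D (t : ℝ) (Z : VFIdx n) (g : V n → ℝ) (p : V n) : ℝ := fderiv ℝ g p (X Z t p)

def DL (t : ℝ) (L : List (VFIdx n)) (g : V n → ℝ) : V n → ℝ := L.foldr (D t) g

@[simp] lemma DL_nil (t : ℝ) (g : V n → ℝ) : DL t [] g = g := rfl
@[simp] lemma DL_cons (t : ℝ) (Z : VFIdx n) (L : List (VFIdx n)) (g : V n → ℝ) :
    DL t (Z :: L) g = D t Z (DL t L g) := rfl

lemma contDiff_X (Z : VFIdx n) (t : ℝ) : ContDiff ℝ ∞ (X Z t) := by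
  unfold X; fun_prop

/-- Smooth functions with compact support. -/
structure Sm (g : V n → ℝ) : Prop where
  smooth : ContDiff ℝ ∞ g
  cpt : HasCompactSupport g

lemma contDiff_D {g : V n → ℝ} (hg : ContDiff ℝ ∞ g) (t : ℝ) (Z : VFIdx n) :
    ContDiff ℝ ∞ (D t Z g) := by
  unfold D
  exact (hg.fderiv_right (m := ∞) le_rfl).clm_apply (contDiff_X Z t)

lemma contDiff_DL {g : V n → ℝ} (hg : ContDiff ℝ ∞ g) (t : ℝ) (L : List (VFIdx n)) :
    ContDiff ℝ ∞ (DL t L g) := by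
  induction L with
  | nil => exact hg
  | cons Z L ih => exact contDiff_D ih t Z

lemma hcs_fderiv_apply {g : V n → ℝ} (hg : HasCompactSupport g) (w : V n → V n) :
    HasCompactSupport (fun p => fderiv ℝ g p (w p)) := by
  refine (hg.fderiv ℝ).mono ?_
  intro p hp
  simp only [Function.mem_support] at hp ⊢
  intro h
  apply hp
  rw [h]; rfl

lemma Sm.D {g : V n → ℝ} (hg : Sm g) (t : ℝ) (Z : VFIdx n) : Sm (D t Z g) :=
  ⟨contDiff_D hg.smooth t Z, hcs_fderiv_apply hg.cpt _⟩

lemma Sm.DL {g : V n → ℝ} (hg : Sm g) (t : ℝ) (L : List (VFIdx n)) : Sm (DL t L g) := by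
  induction L with
  | nil => exact hg
  | cons Z L ih => exact ih.D t Z

lemma Sm.continuous {g : V n → ℝ} (hg : Sm g) : Continuous g := hg.smooth.continuous

lemma Sm.diff {g : V n → ℝ} (hg : Sm g) : Differentiable ℝ g :=
  hg.smooth.differentiable (by simp)

lemma Sm.integrable {g : V n → ℝ} (hg : Sm g) : Integrable g volume :=
  hg.continuous.integrable_of_hasCompactSupport hg.cpt

lemma pd_fst {g : V n → ℝ} (hg : Differentiable ℝ g) (i : Fin n) (x v : E n) :
    pd i (fun y => g (y, v)) x = fderiv ℝ g (x, v) (EuclideanSpace.single i 1, 0) := by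
  unfold pd
  have h : HasFDerivAt (fun y : E n => g (y, v))
      ((fderiv ℝ g (x, v)).comp (ContinuousLinearMap.inl ℝ (E n) (E n))) x :=
    HasFDerivAt.comp x (hg (x, v)).hasFDerivAt (hasFDerivAt_prodMk_left x v)
  rw [h.fderiv]; simp

lemma pd_snd {g : V n → ℝ} (hg : Differentiable ℝ g) (i : Fin n) (x v : E n) :
    pd i (fun w => g (x, w)) v = fderiv ℝ g (x, v) (0, EuclideanSpace.single i 1) := by
  unfold pd
  have h : HasFDerivAt (fun y : E n => g (x, y))
      ((fderiv ℝ g (x, v)).comp (ContinuousLinearMap.inr ℝ (E n) (E n))) v :=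
    HasFDerivAt.comp v (hg (x, v)).hasFDerivAt (hasFDerivAt_prodMk_right x v)
  rw [h.fderiv]; simp

lemma sum_coord (x : E n) : x = ∑ i, x i • (EuclideanSpace.single i (1 : ℝ) : E n) := by
  ext j
  simp [Pi.single_apply]

lemma clm_fst (ℓ : V n →L[ℝ] ℝ) (x : E n) :
    ℓ (x, 0) = ∑ i, x i * ℓ (EuclideanSpace.single i 1, 0) := by
  have h : ∀ y : E n, ℓ (y, 0) = (ℓ.comp (ContinuousLinearMap.inl ℝ (E n) (E n))) y := by
    intro y; simp
  simp only [h]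
  conv_lhs => rw [sum_coord x]
  rw [map_sum]; simp

lemma clm_snd (ℓ : V n →L[ℝ] ℝ) (x : E n) :
    ℓ (0, x) = ∑ i, x i * ℓ (0, EuclideanSpace.single i 1) := by
  have h : ∀ y : E n, ℓ (0, y) = (ℓ.comp (ContinuousLinearMap.inr ℝ (E n) (E n))) y := by
    intro y; simp
  simp only [h]
  conv_lhs => rw [sum_coord x]
  rw [map_sum]; simp

lemma clm_split (ℓ : V n →L[ℝ] ℝ) (x v : E n) : ℓ (x, v) = ℓ (x, 0) + ℓ (0, v) := by
  rw [← map_add]; simp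

lemma microApply_eq (Z : VFIdx n) (f : ℝ → E n → E n → ℝ) (g : V n → ℝ) (t : ℝ)
    (hfg : ∀ x v, f t x v = g (x, v)) (hg : Differentiable ℝ g) (x v : E n) :
    microApply Z f t x v = D t Z g (x, v) := by
  rcases Z with k | k | ⟨⟨k, l⟩, hkl⟩ | u
  · simp only [microApply, hfg, pd_fst hg, D, X, va, vb, AA, vA]
    simp
  · simp only [microApply, hfg, pd_fst hg, pd_snd hg, D, X, va, vb, AA, vA]
    have : (ContinuousLinearMap.prodMap (0 : E n →L[ℝ] E n) (0 : E n →L[ℝ] E n)) (x, v) = 0 := by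
      simp
    rw [← smul_eq_mul, ← map_smul, ← map_add, this]
    simp
  · simp only [microApply, hfg, pd_fst hg, pd_snd hg, D, X, va, vb, AA, vA]
    simp only [← smul_eq_mul, ← map_smul, ← map_add, ← map_sub]
    congr 1
    ext : 1 <;> simp
  · simp only [microApply, hfg, pd_fst hg, pd_snd hg, D, X, va, vb, AA, vA]
    rw [← clm_fst, ← clm_snd, ← clm_split]
    simp

lemma microList_eq (L : List (VFIdx n)) (f : ℝ → E n → E n → ℝ) (g : V n → ℝ) (t : ℝ)
    (hfg : ∀ x v, f t x v = g (x, v)) (hg : ContDiff ℝ ∞ g) (x v : E n) :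
    microList L f t x v = DL t L g (x, v) := by
  induction L generalizing x v with
  | nil => exact hfg x v
  | cons Z L ih =>
    change microApply Z (microList L f) t x v = _
    rw [microApply_eq Z (microList L f) (DL t L g) t ih
      ((contDiff_DL hg t L).differentiable (by simp))]
    rfl

lemma energy_eq (N : ℕ) (f : ℝ → E n → E n → ℝ) (g : V n → ℝ) (t : ℝ)
    (hfg : ∀ x v, f t x v = g (x, v)) (hg : Sm g) :
    energy n N f t = ∑ m ∈ Finset.range (N + 1), ∑ α : Fin m → VFIdx n,
      ∫ p : V n, |DL t (List.ofFn α) g p| := by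
  unfold energy
  refine Finset.sum_congr rfl fun m _ => Finset.sum_congr rfl fun α _ => ?_
  simp only [microList_eq _ f g t hfg hg.smooth]
  rw [Measure.volume_eq_prod, integral_prod]
  exact (hg.DL t _).integrable.abs

end VP

namespace VP
open scoped ContDiff

instance instHaarV : (volume : Measure (V n)).IsAddHaarMeasure := by
  rw [Measure.volume_eq_prod]; infer_instance

/-- Riesz type kernels on phase space depending on position only. -/
def kn (a : ℝ) (q : V n) : ℝ := ‖q.1‖ ^ a

lemma kn_nonneg (a : ℝ) (q : V n) : 0 ≤ kn a q := Real.rpow_nonneg (norm_nonneg _) _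

lemma measurable_kn (a : ℝ) : Measurable (kn a : V n → ℝ) := by
  unfold kn; fun_prop

lemma integrableOn_norm_rpow (hn : 1 ≤ n) {a : ℝ} (ha : -(n : ℝ) < a) {R : ℝ} (hR : 0 < R) :
    IntegrableOn (fun x : E n => ‖x‖ ^ a) (Metric.ball 0 R) := by
  haveI : Nonempty (Fin n) := ⟨⟨0, hn⟩⟩
  haveI : Nontrivial (E n) := inferInstance
  rw [integrableOn_fun_norm_addHaar volume (f := fun r : ℝ => r ^ a)]
  have : IntegrableOn (fun y : ℝ => y ^ ((n : ℝ) - 1 + a)) (Set.Ioo 0 R) := by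
    rw [intervalIntegral.integrableOn_Ioo_rpow_iff hR]; linarith
  refine this.congr_fun ?_ measurableSet_Ioo
  intro y hy
  simp only [finrank_euclideanSpace, Fintype.card_fin, smul_eq_mul]
  rw [Real.rpow_add hy.1, ← Real.rpow_natCast, Nat.cast_sub hn]
  simp

lemma locInt_kn (hn : 1 ≤ n) {a : ℝ} (ha : -(n : ℝ) < a) :
    LocallyIntegrable (kn a : V n → ℝ) := by
  rw [locallyIntegrable_iff]
  intro K hK
  obtain ⟨R, hR, hKR⟩ := hK.isBounded.subset_ball_lt 0 (0 : V n)
  refine IntegrableOn.mono_set ?_ hKR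
  have : Metric.ball (0 : V n) R = Metric.ball (0 : E n) R ×ˢ Metric.ball (0 : E n) R := by
    rw [ball_prod_same]; rfl
  rw [this, IntegrableOn, Measure.volume_eq_prod, ← Measure.prod_restrict]
  haveI : IsFiniteMeasure ((volume : Measure (E n)).restrict (Metric.ball 0 R)) :=
    ⟨by rw [Measure.restrict_apply_univ]; exact measure_ball_lt_top⟩
  exact Integrable.comp_fst (integrableOn_norm_rpow hn ha hR) _

lemma integrable_kn_mul (hn : 1 ≤ n) {a : ℝ} (ha : -(n : ℝ) < a) {g : V n → ℝ}
    (hg : Continuous g) (hc : HasCompactSupport g) : Integrable (fun q => kn a q * g q) := by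
  have := (locInt_kn hn ha).integrable_smul_left_of_hasCompactSupport hg hc
  refine this.congr (Filter.Eventually.of_forall fun q => ?_)
  simp [mul_comm]

lemma ae_fst_ne (hn : 1 ≤ n) : ∀ᵐ q : V n, q.1 ≠ 0 := by
  haveI : Nonempty (Fin n) := ⟨⟨0, hn⟩⟩
  haveI : Nontrivial (E n) := inferInstance
  have h : ∀ᵐ x : E n, x ≠ 0 := by
    exact compl_mem_ae_iff.2 (measure_singleton 0)
  rw [Measure.volume_eq_prod]
  exact Measure.quasiMeasurePreserving_fst.ae h

/-- Regularized kernel. -/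
def kd (s d : ℝ) (q : V n) : ℝ := (‖q.1‖ ^ 2 + d) ^ s

lemma hasFDerivAt_kd (s : ℝ) {d : ℝ} (hd : 0 < d) (q : V n) :
    HasFDerivAt (kd s d : V n → ℝ)
      ((2 * s * kd (s - 1) d q) • (innerSL ℝ q.1).comp (ContinuousLinearMap.fst ℝ (E n) (E n))) q := by
  unfold kd
  have h1 : HasFDerivAt (fun q : V n => ‖q.1‖ ^ 2 + d) _ q :=
    ((hasFDerivAt_fst (𝕜 := ℝ) (E := E n) (F := E n) (p := q)).norm_sq).add_const d
  have h2 := h1.rpow_const (p := s) (Or.inl (by positivity))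
  refine h2.congr_fderiv ?_
  ext e <;> simp <;> ring

lemma continuous_kd (s : ℝ) {d : ℝ} (hd : 0 < d) : Continuous (kd s d : V n → ℝ) :=
  continuous_iff_continuousAt.2 fun q => (hasFDerivAt_kd s hd q).continuousAt

lemma kd_le (s : ℝ) (hs : s ≤ 0) {d : ℝ} (hd : 0 < d) {q : V n} (hq : q.1 ≠ 0) :
    kd s d q ≤ kn (2 * s) q := by
  unfold kd kn
  have : 0 < ‖q.1‖ := norm_pos_iff.2 hq
  rw [Real.rpow_mul this.le, Real.rpow_two]
  exact Real.rpow_le_rpow_of_nonpos (by positivity) (by linarith) hs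

lemma kd_nonneg (s : ℝ) {d : ℝ} (hd : 0 < d) (q : V n) : 0 ≤ kd s d q := by
  unfold kd; positivity

lemma kd_tendsto (s : ℝ) {q : V n} (hq : q.1 ≠ 0) :
    Filter.Tendsto (fun k : ℕ => kd s (1 / ((k : ℝ) + 1)) q) Filter.atTop (nhds (kn (2 * s) q)) := by
  unfold kd kn
  have h0 : 0 < ‖q.1‖ := norm_pos_iff.2 hq
  rw [Real.rpow_mul h0.le, Real.rpow_two]
  have h1 : Filter.Tendsto (fun k : ℕ => ‖q.1‖ ^ 2 + 1 / ((k : ℝ) + 1)) Filter.atTop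
      (nhds (‖q.1‖ ^ 2 + 0)) := tendsto_const_nhds.add tendsto_one_div_add_atTop_nhds_zero_nat
  rw [add_zero] at h1
  exact h1.rpow_const (Or.inl (by positivity))

/-- The weak derivative of the Newtonian kernel. -/
lemma weak_deriv (hn : 3 ≤ n) {G : V n → ℝ} (hG : ContDiff ℝ 1 G) (hc : HasCompactSupport G)
    (e : V n) :
    ∫ q, kn (2 - n) q * fderiv ℝ G q e
      = (n - 2) * ∫ q : V n, kn (-n) q * inner ℝ q.1 e.1 * G q := by
  have hn1 : 1 ≤ n := by omega
  have hnR : (3 : ℝ) ≤ n := by exact_mod_cast hn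
  have hGd : Differentiable ℝ G := hG.differentiable (by simp)
  have hG'c : Continuous (fun q => fderiv ℝ G q e) :=
    (hG.continuous_fderiv (by simp)).clm_apply continuous_const
  have hG's : HasCompactSupport (fun q => fderiv ℝ G q e) := hcs_fderiv_apply hc (fun _ => e)
  have hreg : ∀ k : ℕ, ∫ q, kd ((2 - n) / 2) (1 / ((k : ℝ) + 1)) q * fderiv ℝ G q e
      = (n - 2) * ∫ q : V n, kd (-n / 2) (1 / ((k : ℝ) + 1)) q * inner ℝ q.1 e.1 * G q := by
    intro k
    have hd : (0 : ℝ) < 1 / ((k : ℝ) + 1) := by positivity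
    have hfd : ∀ q : V n, fderiv ℝ (kd ((2 - n) / 2) (1 / ((k : ℝ) + 1)) : V n → ℝ) q e
        = (2 - n) * (kd (-n / 2) (1 / ((k : ℝ) + 1)) q * inner ℝ q.1 e.1) := by
      intro q
      rw [(hasFDerivAt_kd _ hd q).fderiv]
      simp
      rw [show ((2 : ℝ) - n) / 2 - 1 = -n / 2 by ring]
      ring
    rw [integral_mul_fderiv_eq_neg_fderiv_mul_of_integrable]
    · simp only [hfd]
      rw [← integral_neg, ← integral_const_mul]
      congr 1; ext q; ring
    · simp only [hfd]
      refine Continuous.integrable_of_hasCompactSupport ?_ hc.mul_left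
      have := continuous_kd (n := n) (-n / 2) hd
      have := hG.continuous
      fun_prop
    · exact ((continuous_kd _ hd).mul hG'c).integrable_of_hasCompactSupport hG's.mul_left
    · exact ((continuous_kd _ hd).mul hG.continuous).integrable_of_hasCompactSupport hc.mul_left
    · intro x _; exact (hasFDerivAt_kd _ hd x).differentiableAt
    · intro x _; exact hGd x
  have hd : ∀ k : ℕ, (0 : ℝ) < 1 / ((k : ℝ) + 1) := fun k => by positivity
  have hl : Filter.Tendsto (fun k : ℕ =>
      ∫ q, kd ((2 - n) / 2) (1 / ((k : ℝ) + 1)) q * fderiv ℝ G q e) Filter.atTop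
      (nhds (∫ q, kn (2 - n) q * fderiv ℝ G q e)) := by
    refine tendsto_integral_of_dominated_convergence
      (fun q => kn (2 - n) q * |fderiv ℝ G q e|) ?_ ?_ ?_ ?_
    · intro k
      exact ((continuous_kd _ (hd k)).mul hG'c).aestronglyMeasurable
    · exact integrable_kn_mul hn1 (by linarith) hG'c.abs hG's.abs
    · intro k
      filter_upwards [ae_fst_ne hn1] with q hq
      rw [norm_mul, Real.norm_eq_abs, Real.norm_eq_abs, abs_of_nonneg (kd_nonneg _ (hd k) q)]
      have := kd_le ((2 - n) / 2) (by linarith) (hd k) hq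
      rw [mul_div_cancel₀ _ (two_ne_zero)] at this
      gcongr
    · filter_upwards [ae_fst_ne hn1] with q hq
      have := kd_tendsto ((2 - n) / 2) hq
      rw [mul_div_cancel₀ _ (two_ne_zero)] at this
      exact this.mul_const _
  have hr : Filter.Tendsto (fun k : ℕ =>
      ∫ q : V n, kd (-n / 2) (1 / ((k : ℝ) + 1)) q * inner ℝ q.1 e.1 * G q) Filter.atTop
      (nhds (∫ q : V n, kn (-n) q * inner ℝ q.1 e.1 * G q)) := by
    refine tendsto_integral_of_dominated_convergence
      (fun q => kn (1 - n) q * (‖e.1‖ * |G q|)) ?_ ?_ ?_ ?_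
    · intro k
      have := continuous_kd (n := n) (-n / 2) (hd k)
      have := hG.continuous
      refine Continuous.aestronglyMeasurable ?_
      fun_prop
    · refine integrable_kn_mul hn1 (by linarith) ?_ ?_
      · have := hG.continuous; fun_prop
      · exact hc.abs.mul_left
    · intro k
      filter_upwards [ae_fst_ne hn1] with q hq
      rw [norm_mul, norm_mul, Real.norm_eq_abs, Real.norm_eq_abs, Real.norm_eq_abs,
        abs_of_nonneg (kd_nonneg _ (hd k) q)]
      have h1 := kd_le (-n / 2) (by linarith) (hd k) hq
      rw [mul_div_cancel₀ _ (two_ne_zero)] at h1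
      have h2 : kn (1 - n) q = kn (-n) q * ‖q.1‖ := by
        unfold kn
        rw [sub_eq_neg_add, Real.rpow_add (norm_pos_iff.2 hq), Real.rpow_one]
      have h3 := abs_real_inner_le_norm q.1 e.1
      rw [h2]
      calc _ ≤ kn (-n) q * (‖q.1‖ * ‖e.1‖) * |G q| := by
            gcongr
            exact kn_nonneg _ _
        _ = _ := by ring
    · filter_upwards [ae_fst_ne hn1] with q hq
      have := kd_tendsto (-n / 2) hq
      rw [mul_div_cancel₀ _ (two_ne_zero)] at this
      exact (this.mul_const _).mul_const _
  simp only [hreg] at hl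
  exact tendsto_nhds_unique hl (hr.const_mul _)

end VP

namespace VP
open scoped ContDiff

/-- The potential (without constants) generated by a phase-space density. -/
def Phi (g : V n → ℝ) (p : V n) : ℝ := ∫ q : V n, kn (2 - n) q * g (p - q)

lemma Phi_eq_conv (g : V n → ℝ) :
    Phi g = convolution (kn (2 - n)) g (ContinuousLinearMap.mul ℝ ℝ) volume := by
  ext p; rfl

lemma two_sub_gt (hn : 3 ≤ n) : -(n : ℝ) < 2 - n := by linarith

lemma contDiff_Phi (hn : 3 ≤ n) {g : V n → ℝ} (hg : Sm g) : ContDiff ℝ ∞ (Phi g) := by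
  rw [Phi_eq_conv]
  exact hg.cpt.contDiff_convolution_right _ (locInt_kn (by omega) (two_sub_gt hn)) hg.smooth

lemma hcs_reflect {g : V n → ℝ} (hg : HasCompactSupport g) (p : V n) :
    HasCompactSupport (fun q => g (p - q)) :=
  hg.comp_homeomorph (Homeomorph.subLeft p)

lemma fderiv_reflect {g : V n → ℝ} (hg : Differentiable ℝ g) (p q e : V n) :
    fderiv ℝ (fun q => g (p - q)) q e = - fderiv ℝ g (p - q) e := by
  have h : HasFDerivAt (fun q => g (p - q)) ((fderiv ℝ g (p - q)).comp
      (-(ContinuousLinearMap.id ℝ (V n)))) q :=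
    HasFDerivAt.comp q (hg (p - q)).hasFDerivAt ((hasFDerivAt_id q).const_sub p)
  rw [h.fderiv]; simp

lemma fderiv_Phi (hn : 3 ≤ n) {g : V n → ℝ} (hg : Sm g) (p e : V n) :
    fderiv ℝ (Phi g) p e = ∫ q : V n, kn (2 - n) q * fderiv ℝ g (p - q) e := by
  have hloc := locInt_kn (n := n) (by omega) (two_sub_gt hn)
  have hg1 : ContDiff ℝ 1 g := hg.smooth.of_le (by exact_mod_cast le_top)
  have h := hg.cpt.hasFDerivAt_convolution_right (ContinuousLinearMap.mul ℝ ℝ) hloc hg1 p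
  rw [Phi_eq_conv, h.fderiv]
  unfold convolution
  rw [ContinuousLinearMap.integral_apply]
  · rfl
  · exact (hg.cpt.fderiv ℝ).convolutionExists_right _ hloc (hg1.continuous_fderiv (by simp)) p

lemma abs_kn_inner_le (q : V n) (e : E n) :
    |kn (-n) q * inner ℝ q.1 e| ≤ kn (1 - n) q * ‖e‖ := by
  rcases eq_or_ne q.1 0 with h0 | h0
  · rw [h0, inner_zero_left, mul_zero, abs_zero]
    exact mul_nonneg (kn_nonneg _ _) (norm_nonneg _)
  · have h2 : kn (1 - n) q = kn (-n) q * ‖q.1‖ := by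
      unfold kn
      rw [sub_eq_neg_add, Real.rpow_add (norm_pos_iff.2 h0), Real.rpow_one]
    rw [h2, abs_mul, abs_of_nonneg (kn_nonneg _ _), mul_assoc]
    exact mul_le_mul_of_nonneg_left (abs_real_inner_le_norm q.1 e) (kn_nonneg _ _)

lemma weak_dilation (hn : 3 ≤ n) {G : V n → ℝ} (hG : Sm G) (Z : VFIdx n) :
    ∫ q : V n, kn (2 - n) q * fderiv ℝ G q (AA Z q)
      = - ((n + 2) * vc Z) * ∫ q : V n, kn (2 - n) q * G q := by
  have hn1 : 1 ≤ n := by omega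
  have hc1 : ∀ (i : Fin n), ContDiff ℝ ∞ (fun q : V n => vA Z q.1 i * G q) := by
    intro i
    have := hG.smooth
    have h2 : ContDiff ℝ ∞ (fun q : V n => (EuclideanSpace.proj i : E n →L[ℝ] ℝ) (vA Z q.1)) := by
      fun_prop
    exact h2.mul this
  have hc2 : ∀ (i : Fin n), ContDiff ℝ ∞ (fun q : V n => vA Z q.2 i * G q) := by
    intro i
    have := hG.smooth
    have h2 : ContDiff ℝ ∞ (fun q : V n => (EuclideanSpace.proj i : E n →L[ℝ] ℝ) (vA Z q.2)) := by
      fun_prop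
    exact h2.mul this
  have hs1 : ∀ (i : Fin n), HasCompactSupport (fun q : V n => vA Z q.1 i * G q) :=
    fun i => hG.cpt.mul_left
  have hs2 : ∀ (i : Fin n), HasCompactSupport (fun q : V n => vA Z q.2 i * G q) :=
    fun i => hG.cpt.mul_left
  have hd1 : ∀ (i : Fin n) (q : V n), fderiv ℝ (fun q : V n => vA Z q.1 i * G q) q
      (EuclideanSpace.single i 1, 0) = vA Z (EuclideanSpace.single i 1) i * G q
        + vA Z q.1 i * fderiv ℝ G q (EuclideanSpace.single i 1, 0) := by
    intro i q
    have h2 : HasFDerivAt (fun q : V n => vA Z q.1 i)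
      ((EuclideanSpace.proj i : E n →L[ℝ] ℝ).comp ((vA Z).comp
        (ContinuousLinearMap.fst ℝ (E n) (E n)))) q :=
      ((EuclideanSpace.proj i : E n →L[ℝ] ℝ).comp ((vA Z).comp
        (ContinuousLinearMap.fst ℝ (E n) (E n)))).hasFDerivAt
    rw [(h2.fun_mul (hG.diff q).hasFDerivAt).fderiv]
    simp; ring
  have hd2 : ∀ (i : Fin n) (q : V n), fderiv ℝ (fun q : V n => vA Z q.2 i * G q) q
      (0, EuclideanSpace.single i 1) = vA Z (EuclideanSpace.single i 1) i * G q
        + vA Z q.2 i * fderiv ℝ G q (0, EuclideanSpace.single i 1) := by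
    intro i q
    have h2 : HasFDerivAt (fun q : V n => vA Z q.2 i)
      ((EuclideanSpace.proj i : E n →L[ℝ] ℝ).comp ((vA Z).comp
        (ContinuousLinearMap.snd ℝ (E n) (E n)))) q :=
      ((EuclideanSpace.proj i : E n →L[ℝ] ℝ).comp ((vA Z).comp
        (ContinuousLinearMap.snd ℝ (E n) (E n)))).hasFDerivAt
    rw [(h2.fun_mul (hG.diff q).hasFDerivAt).fderiv]
    simp; ring
  have hone : (1 : WithTop ℕ∞) ≤ ∞ := by exact_mod_cast le_top
  have hi : ∀ (H : V n → ℝ) (_ : ContDiff ℝ ∞ H) (_ : HasCompactSupport H) (e : V n),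
      Integrable (fun q => kn (2 - n) q * fderiv ℝ H q e) := by
    intro H h1 h2 e
    refine integrable_kn_mul hn1 (two_sub_gt hn) ?_ (hcs_fderiv_apply h2 (fun _ => e))
    exact (h1.continuous_fderiv (by simp)).clm_apply continuous_const
  have key : ∫ q : V n, kn (2 - n) q * (2 * (n * vc Z) * G q + fderiv ℝ G q (AA Z q))
      = (n - 2) * vc Z * ∫ q : V n, kn (2 - n) q * G q := by
    have e1 : ∀ q : V n, kn (2 - n) q * (2 * (n * vc Z) * G q + fderiv ℝ G q (AA Z q))
        = ∑ i, (kn (2 - n) q * fderiv ℝ (fun q : V n => vA Z q.1 i * G q) q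
            (EuclideanSpace.single i 1, 0)
          + kn (2 - n) q * fderiv ℝ (fun q : V n => vA Z q.2 i * G q) q
            (0, EuclideanSpace.single i 1)) := by
      intro q
      simp only [hd1, hd2]
      have : fderiv ℝ G q (AA Z q) = fderiv ℝ G q (vA Z q.1, vA Z q.2) := rfl
      rw [this, clm_split, clm_fst, clm_snd, ← vA_trace Z]
      simp only [mul_add, Finset.sum_add_distrib, ← Finset.mul_sum, ← Finset.sum_mul]
      ring
    simp only [e1]
    rw [integral_finset_sum]
    · have e2 : ∀ i : Fin n, ∫ q : V n, (kn (2 - n) q * fderiv ℝ (fun q : V n => vA Z q.1 i * G q) q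
            (EuclideanSpace.single i 1, 0)
          + kn (2 - n) q * fderiv ℝ (fun q : V n => vA Z q.2 i * G q) q
            (0, EuclideanSpace.single i 1))
          = (n - 2) * ∫ q : V n, kn (-n) q * (q.1 i) * (vA Z q.1 i * G q) := by
        intro i
        rw [integral_add (hi _ (hc1 i) (hs1 i) _) (hi _ (hc2 i) (hs2 i) _)]
        rw [weak_deriv hn ((hc1 i).of_le hone) (hs1 i), weak_deriv hn ((hc2 i).of_le hone) (hs2 i)]
        simp [EuclideanSpace.inner_single_right]
      simp only [e2]
      rw [← Finset.mul_sum, ← integral_finset_sum, mul_assoc, ← integral_const_mul (vc Z)]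
      · congr 1
        apply integral_congr_ae
        filter_upwards with q
        show ∑ i, kn (-n) q * (q.1 i) * (vA Z q.1 i * G q) = vc Z * (kn (2 - n) q * G q)
        have h3 : ∑ i, kn (-n) q * (q.1 i) * (vA Z q.1 i * G q)
            = kn (-n) q * (inner ℝ q.1 (vA Z q.1)) * G q := by
          rw [PiLp.inner_apply, Finset.mul_sum, Finset.sum_mul]
          refine Finset.sum_congr rfl fun i _ => ?_
          simp; ring
        rw [h3, vA_inner]
        have h4 : kn (-n) q * ‖q.1‖ ^ 2 = kn (2 - n) q := by
          unfold kn
          rcases eq_or_ne q.1 0 with h0 | h0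
          · have h9 : (3 : ℝ) ≤ n := by exact_mod_cast hn
            have h10 : (2 : ℝ) - n ≠ 0 := by linarith
            rw [h0, norm_zero, Real.zero_rpow h10]
            simp
          · rw [sub_eq_neg_add, Real.rpow_add (norm_pos_iff.2 h0), Real.rpow_two]
        rw [← h4]; ring
      · intro i _
        have := integrable_kn_mul hn1 (a := 1 - n) (by linarith) (hc1 i).continuous.abs (hs1 i).abs
        refine this.mono' ?_ (Filter.Eventually.of_forall fun q => ?_)
        · have h5 := measurable_kn (n := n) (-n)
          have h6 := (hc1 i).continuous.measurable
          have h7 : Measurable (fun q : V n => q.1 i) := by fun_prop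
          exact ((h5.mul h7).mul h6).aestronglyMeasurable
        · have h8 := abs_kn_inner_le q (EuclideanSpace.single i (1 : ℝ))
          simp only [EuclideanSpace.inner_single_right] at h8
          simp at h8
          rw [norm_mul, Real.norm_eq_abs, Real.norm_eq_abs, abs_mul]
          gcongr
    · intro i _
      exact (hi _ (hc1 i) (hs1 i) _).add (hi _ (hc2 i) (hs2 i) _)
  have e3 : ∀ q : V n, kn (2 - n) q * (2 * (n * vc Z) * G q + fderiv ℝ G q (AA Z q))
      = (2 * (n * vc Z)) * (kn (2 - n) q * G q) + kn (2 - n) q * fderiv ℝ G q (AA Z q) := by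
    intro q; ring
  simp only [e3] at key
  rw [integral_add, integral_const_mul] at key
  · linarith
  · exact (integrable_kn_mul hn1 (two_sub_gt hn) hG.continuous hG.cpt).const_mul _
  · refine integrable_kn_mul hn1 (two_sub_gt hn) ?_ (hcs_fderiv_apply hG.cpt _)
    exact (hG.smooth.continuous_fderiv (by simp)).clm_apply (AA Z).continuous

lemma Sm.reflect {g : V n → ℝ} (hg : Sm g) (p : V n) : Sm (fun q => g (p - q)) :=
  ⟨hg.smooth.comp (contDiff_const.sub contDiff_id), hcs_reflect hg.cpt p⟩

/-- Potential commutes with the vector fields up to lower order terms. -/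
lemma D_Phi (hn : 3 ≤ n) {g : V n → ℝ} (hg : Sm g) (t : ℝ) (Z : VFIdx n) (p : V n) :
    D t Z (Phi g) p = Phi (D t Z g) p + (n + 2) * vc Z * Phi g p := by
  have hn1 : 1 ≤ n := by omega
  unfold D
  rw [fderiv_Phi hn hg]
  have hd := weak_dilation hn (hg.reflect p) Z
  simp only [fderiv_reflect hg.diff] at hd
  have e : ∀ q, kn (2 - n) q * fderiv ℝ g (p - q) (X Z t p)
      = kn (2 - n) q * D t Z g (p - q) - kn (2 - n) q * - fderiv ℝ g (p - q) (AA Z q) := by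
    intro q
    have : X Z t p = X Z t (p - q) + AA Z q := by
      unfold X; rw [map_sub]; abel
    rw [this, map_add]
    unfold D; ring
  simp only [e]
  rw [integral_sub, hd]
  · unfold Phi D; ring
  · exact integrable_kn_mul hn1 (two_sub_gt hn) ((hg.D t Z).reflect p).continuous
      ((hg.D t Z).reflect p).cpt
  · refine integrable_kn_mul hn1 (two_sub_gt hn) ?_ ?_
    · have := (hg.smooth.continuous_fderiv (by simp))
      fun_prop
    · have := hcs_fderiv_apply (hg.reflect p).cpt (fun q => AA Z q)
      simpa only [fderiv_reflect hg.diff] using this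

lemma grad_Phi_le (hn : 3 ≤ n) {g : V n → ℝ} (hg : Sm g) (p e : V n) :
    |fderiv ℝ (Phi g) p e| ≤ n * ‖e.1‖ * ∫ q : V n, kn (1 - n) q * |g (p - q)| := by
  have hn1 : 1 ≤ n := by omega
  have hnR : (3 : ℝ) ≤ n := by exact_mod_cast hn
  have hone : (1 : WithTop ℕ∞) ≤ ∞ := by exact_mod_cast le_top
  rw [fderiv_Phi hn hg]
  have hd := weak_deriv hn ((hg.reflect p).smooth.of_le hone) (hg.reflect p).cpt e
  simp only [fderiv_reflect hg.diff, mul_neg, integral_neg] at hd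
  have hinteg : Integrable (fun q => kn (1 - n) q * |g (p - q)|) :=
    integrable_kn_mul hn1 (by linarith) (hg.reflect p).continuous.abs (hg.reflect p).cpt.abs
  rw [← abs_neg, hd, abs_mul, mul_assoc]
  have h0 : |(n : ℝ) - 2| ≤ n := by rw [abs_le]; constructor <;> linarith
  refine mul_le_mul h0 ?_ (abs_nonneg _) (by linarith)
  rw [← integral_const_mul, ← Real.norm_eq_abs]
  refine norm_integral_le_of_norm_le (hinteg.const_mul _) (Filter.Eventually.of_forall fun q => ?_)
  rw [Real.norm_eq_abs, abs_mul]
  calc _ ≤ (kn (1 - n) q * ‖e.1‖) * |g (p - q)| := by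
        gcongr; exact abs_kn_inner_le q e.1
    _ = _ := by ring

end VP

namespace VP
open scoped ContDiff

lemma snd_symm {F : Type*} [NormedAddCommGroup F] [NormedSpace ℝ F] {P : F → ℝ}
    (hP : ContDiff ℝ ∞ P) (p a b : F) :
    fderiv ℝ (fderiv ℝ P) p a b = fderiv ℝ (fderiv ℝ P) p b a := by
  have h : IsSymmSndFDerivAt ℝ P p :=
    (hP.contDiffAt).isSymmSndFDerivAt (by
      simp only [minSmoothness_of_isRCLikeNormedField]
      exact WithTop.coe_le_coe.2 (le_top : (2 : ℕ∞) ≤ ⊤))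
  exact h a b

lemma hasFDerivAt_fderiv {F : Type*} [NormedAddCommGroup F] [NormedSpace ℝ F] {P : F → ℝ}
    (hP : ContDiff ℝ ∞ P) (p : F) : HasFDerivAt (fderiv ℝ P) (fderiv ℝ (fderiv ℝ P) p) p :=
  ((hP.fderiv_right (m := ∞) le_rfl).differentiable (by simp) p).hasFDerivAt

/-- derivative of `p ↦ DP(p)[W p]`. -/
lemma hasFDerivAt_dir {F : Type*} [NormedAddCommGroup F] [NormedSpace ℝ F] {P : F → ℝ}
    (hP : ContDiff ℝ ∞ P) {W : F → F} {W' : F →L[ℝ] F} {p : F} (hW : HasFDerivAt W W' p) :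
    HasFDerivAt (fun p => fderiv ℝ P p (W p))
      ((fderiv ℝ P p).comp W' + (fderiv ℝ (fderiv ℝ P) p).flip (W p)) p :=
  (hasFDerivAt_fderiv hP p).clm_apply hW

lemma hasFDerivAt_X (Z : VFIdx n) (t : ℝ) (p : V n) : HasFDerivAt (X Z t) (AA Z) p := by
  unfold X
  exact (AA Z).hasFDerivAt.const_add _

lemma fderiv_D {P : V n → ℝ} (hP : ContDiff ℝ ∞ P) (t : ℝ) (Z : VFIdx n) (p e : V n) :
    fderiv ℝ (D t Z P) p e = fderiv ℝ P p (AA Z e) + fderiv ℝ (fderiv ℝ P) p e (X Z t p) := by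
  unfold D
  rw [(hasFDerivAt_dir hP (hasFDerivAt_X Z t p)).fderiv]
  simp

lemma D_dir {P : V n → ℝ} (hP : ContDiff ℝ ∞ P) (t : ℝ) (Z : VFIdx n) (p e : V n) :
    D t Z (fun p => fderiv ℝ P p e) p = fderiv ℝ (D t Z P) p e - fderiv ℝ P p (AA Z e) := by
  rw [fderiv_D hP, add_sub_cancel_left]
  unfold D
  rw [(hasFDerivAt_dir hP (hasFDerivAt_const e p)).fderiv, snd_symm hP]
  simp

/-- The bilinear Vlasov nonlinearity. -/
def B (g h : V n → ℝ) (p : V n) : ℝ :=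
  ∑ i, fderiv ℝ (Phi g) p (EuclideanSpace.single i 1, 0) * fderiv ℝ h p (0, EuclideanSpace.single i 1)

lemma contDiff_dir {P : V n → ℝ} (hP : ContDiff ℝ ∞ P) (e : V n) :
    ContDiff ℝ ∞ (fun p => fderiv ℝ P p e) :=
  (hP.fderiv_right (m := ∞) le_rfl).clm_apply contDiff_const

lemma contDiff_B (hn : 3 ≤ n) {g h : V n → ℝ} (hg : Sm g) (hh : Sm h) : ContDiff ℝ ∞ (B g h) := by
  unfold B
  exact ContDiff.sum fun i _ => (contDiff_dir (contDiff_Phi hn hg) _).mul (contDiff_dir hh.smooth _)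

lemma D_add {P Q : V n → ℝ} (hP : Differentiable ℝ P) (hQ : Differentiable ℝ Q) (t : ℝ)
    (Z : VFIdx n) (p : V n) : D t Z (fun p => P p + Q p) p = D t Z P p + D t Z Q p := by
  unfold D
  rw [fderiv_fun_add (hP p) (hQ p)]; simp

lemma D_const_mul {P : V n → ℝ} (hP : Differentiable ℝ P) (c : ℝ) (t : ℝ)
    (Z : VFIdx n) (p : V n) : D t Z (fun p => c * P p) p = c * D t Z P p := by
  unfold D
  rw [fderiv_const_mul (hP p)]; simp

lemma D_B (hn : 3 ≤ n) {g h : V n → ℝ} (hg : Sm g) (hh : Sm h) (t : ℝ) (Z : VFIdx n) (p : V n) :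
    D t Z (B g h) p = B (D t Z g) h p + n * vc Z * B g h p + B g (D t Z h) p := by
  have hP := contDiff_Phi hn hg
  have hPZ := contDiff_Phi hn (hg.D t Z)
  have hPd : Differentiable ℝ (Phi g) := hP.differentiable (by simp)
  have hPZd : Differentiable ℝ (Phi (D t Z g)) := hPZ.differentiable (by simp)
  have h1 : D t Z (B g h) p = ∑ i : Fin n,
      (D t Z (fun p => fderiv ℝ (Phi g) p (EuclideanSpace.single i 1, 0)) p
        * fderiv ℝ h p (0, EuclideanSpace.single i 1)
      + fderiv ℝ (Phi g) p (EuclideanSpace.single i 1, 0)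
        * D t Z (fun p => fderiv ℝ h p (0, EuclideanSpace.single i 1)) p) := by
    unfold B D
    rw [fderiv_fun_sum]
    · rw [sum_apply]
      refine Finset.sum_congr rfl fun i _ => ?_
      rw [fderiv_fun_mul]
      · simp; ring
      · exact ((contDiff_dir hP _).differentiable (by simp)) p
      · exact ((contDiff_dir hh.smooth _).differentiable (by simp)) p
    · intro i _
      exact ((contDiff_dir hP _).differentiable (by simp) p).mul
        ((contDiff_dir hh.smooth _).differentiable (by simp) p)
  have h2 : ∀ e, fderiv ℝ (D t Z (Phi g)) p e
      = fderiv ℝ (Phi (D t Z g)) p e + (n + 2) * vc Z * fderiv ℝ (Phi g) p e := by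
    intro e
    have : D t Z (Phi g) = fun p => Phi (D t Z g) p + (n + 2) * vc Z * Phi g p := by
      ext p; exact D_Phi hn hg t Z p
    rw [this, fderiv_fun_add (hPZd p) ((hPd p).const_mul _), fderiv_const_mul (hPd p)]
    simp
  rw [h1]
  simp only [D_dir hP, D_dir hh.smooth, h2]
  have h3 : ∀ i : Fin n, AA Z (EuclideanSpace.single i 1, 0) = (vA Z (EuclideanSpace.single i 1), 0) := by
    intro i; simp [AA]
  have h4 : ∀ i : Fin n, AA Z (0, EuclideanSpace.single i 1) = (0, vA Z (EuclideanSpace.single i 1)) := by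
    intro i; simp [AA]
  simp only [h3, h4]
  set P' := fderiv ℝ (Phi g) p
  set H' := fderiv ℝ h p
  have h5 : ∑ i : Fin n, (P' (vA Z (EuclideanSpace.single i 1), 0) * H' (0, EuclideanSpace.single i 1)
      + P' (EuclideanSpace.single i 1, 0) * H' (0, vA Z (EuclideanSpace.single i 1)))
      = 2 * vc Z * B g h p := by
    have : ∀ i : Fin n, P' (vA Z (EuclideanSpace.single i 1), 0) = _ := fun i => clm_fst P' _
    simp only [this]
    have : ∀ i : Fin n, H' (0, vA Z (EuclideanSpace.single i 1)) = _ := fun i => clm_snd H' _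
    simp only [this, Finset.sum_add_distrib, Finset.sum_mul, Finset.mul_sum]
    nth_rewrite 1 [Finset.sum_comm]
    rw [← Finset.sum_add_distrib]
    unfold B
    rw [Finset.mul_sum]
    refine Finset.sum_congr rfl fun i _ => ?_
    rw [← Finset.sum_add_distrib]
    have h6 : ∀ j : Fin n, (vA Z (EuclideanSpace.single j 1)) i * P' (EuclideanSpace.single i 1, 0)
          * H' (0, EuclideanSpace.single j 1) + P' (EuclideanSpace.single i 1, 0)
          * ((vA Z (EuclideanSpace.single i 1)) j * H' (0, EuclideanSpace.single j 1))
        = (2 * vc Z * (if i = j then 1 else 0)) * (P' (EuclideanSpace.single i 1, 0)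
          * H' (0, EuclideanSpace.single j 1)) := by
      intro j
      rw [← vA_symm Z i j]; ring
    simp only [h6]
    simp [P', H']
  have h7 : ∀ i : Fin n,
      (fderiv ℝ (Phi (D t Z g)) p (EuclideanSpace.single i 1, 0)
        + (n + 2) * vc Z * P' (EuclideanSpace.single i 1, 0)
        - P' (vA Z (EuclideanSpace.single i 1), 0)) * H' (0, EuclideanSpace.single i 1)
      + P' (EuclideanSpace.single i 1, 0) * (fderiv ℝ (D t Z h) p (0, EuclideanSpace.single i 1)
        - H' (0, vA Z (EuclideanSpace.single i 1)))
      = fderiv ℝ (Phi (D t Z g)) p (EuclideanSpace.single i 1, 0) * H' (0, EuclideanSpace.single i 1)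
        + (n + 2) * vc Z * (P' (EuclideanSpace.single i 1, 0) * H' (0, EuclideanSpace.single i 1))
        + P' (EuclideanSpace.single i 1, 0) * fderiv ℝ (D t Z h) p (0, EuclideanSpace.single i 1)
        - (P' (vA Z (EuclideanSpace.single i 1), 0) * H' (0, EuclideanSpace.single i 1)
      + P' (EuclideanSpace.single i 1, 0) * H' (0, vA Z (EuclideanSpace.single i 1))) := by
    intro i; ring
  simp only [h7]
  rw [Finset.sum_sub_distrib, h5]
  simp only [Finset.sum_add_distrib, ← Finset.mul_sum]
  unfold B
  simp only [P', H']
  ring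

/-- Index type of the terms in the expansion of `Z^L B(f,f)`. -/
abbrev Trm (n : ℕ) : Type := ℝ × List (VFIdx n) × List (VFIdx n)

def stepT (Z : VFIdx n) (T : List (Trm n)) : List (Trm n) :=
  T.flatMap fun τ => [(τ.1, Z :: τ.2.1, τ.2.2), (τ.1 * (n * vc Z), τ.2.1, τ.2.2),
    (τ.1, τ.2.1, Z :: τ.2.2)]

def Terms : List (VFIdx n) → List (Trm n)
  | [] => []
  | Z :: L => (1, [Z], L) :: (n * vc Z, [], L) :: stepT Z (Terms L)

lemma Terms_len (L : List (VFIdx n)) : ∀ τ ∈ Terms L,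
    τ.2.1.length + τ.2.2.length ≤ L.length ∧ τ.2.2.length + 1 ≤ L.length := by
  induction L with
  | nil => intro τ hτ; simp [Terms] at hτ
  | cons Z L ih =>
    intro τ hτ
    simp only [Terms, stepT, List.mem_cons, List.mem_flatMap] at hτ
    rcases hτ with rfl | rfl | ⟨σ, hσ, hτ⟩
    · simp; omega
    · simp
    · have := ih σ hσ
      simp only [List.mem_cons, List.not_mem_nil, or_false] at hτ
      rcases hτ with rfl | rfl | rfl <;> simp <;> omega

def evalT (t : ℝ) (f : V n → ℝ) (T : List (Trm n)) (p : V n) : ℝ :=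
  (T.map fun τ => τ.1 * B (DL t τ.2.1 f) (DL t τ.2.2 f) p).sum

lemma evalT_cons (t : ℝ) (f : V n → ℝ) (τ : Trm n) (T : List (Trm n)) (p : V n) :
    evalT t f (τ :: T) p = τ.1 * B (DL t τ.2.1 f) (DL t τ.2.2 f) p + evalT t f T p := by
  simp [evalT]

lemma contDiff_evalT (hn : 3 ≤ n) {f : V n → ℝ} (hf : Sm f) (t : ℝ) (T : List (Trm n)) :
    ContDiff ℝ ∞ (evalT t f T) := by
  induction T with
  | nil => unfold evalT; simp; exact contDiff_const
  | cons τ T ih =>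
    have : evalT t f (τ :: T) = fun p => τ.1 * B (DL t τ.2.1 f) (DL t τ.2.2 f) p + evalT t f T p := by
      ext p; exact evalT_cons t f τ T p
    rw [this]
    exact (contDiff_const.mul (contDiff_B hn (hf.DL t _) (hf.DL t _))).add ih

lemma D_evalT (hn : 3 ≤ n) {f : V n → ℝ} (hf : Sm f) (t : ℝ) (Z : VFIdx n) (T : List (Trm n))
    (p : V n) : D t Z (evalT t f T) p = evalT t f (stepT Z T) p := by
  induction T with
  | nil =>
    have h : evalT t f ([] : List (Trm n)) = fun _ => 0 := by ext p; simp [evalT]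
    have h' : stepT Z ([] : List (Trm n)) = [] := rfl
    rw [h', h]; simp [D]
  | cons τ T ih =>
    have : evalT t f (τ :: T) = fun p => τ.1 * B (DL t τ.2.1 f) (DL t τ.2.2 f) p + evalT t f T p := by
      ext p; exact evalT_cons t f τ T p
    have hB := (contDiff_B hn (hf.DL t τ.2.1) (hf.DL t τ.2.2)).differentiable (by simp)
    rw [this, D_add (hB.const_mul _) ((contDiff_evalT hn hf t T).differentiable (by simp)),
      D_const_mul hB, ih, D_B hn (hf.DL t _) (hf.DL t _)]
    have h' : stepT Z (τ :: T) = (τ.1, Z :: τ.2.1, τ.2.2) :: (τ.1 * (n * vc Z), τ.2.1, τ.2.2) ::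
      (τ.1, τ.2.1, Z :: τ.2.2) :: stepT Z T := rfl
    rw [h', evalT_cons, evalT_cons, evalT_cons]
    simp only [DL_cons]
    ring

lemma DL_B (hn : 3 ≤ n) {f : V n → ℝ} (hf : Sm f) (t : ℝ) (L : List (VFIdx n)) (p : V n) :
    DL t L (B f f) p = B f (DL t L f) p + evalT t f (Terms L) p := by
  induction L generalizing p with
  | nil => simp [evalT, Terms]
  | cons Z L ih =>
    have : DL t L (B f f) = fun p => B f (DL t L f) p + evalT t f (Terms L) p := by
      ext p; exact ih p
    rw [DL_cons, this, D_add ((contDiff_B hn hf (hf.DL t _)).differentiable (by simp))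
      ((contDiff_evalT hn hf t _).differentiable (by simp)), D_evalT hn hf, D_B hn hf (hf.DL t _)]
    rw [Terms, evalT_cons, evalT_cons]
    simp only [DL_cons, DL_nil]
    ring

end VP

namespace VP
open scoped ContDiff ENNReal

/-- directional embedding -/
def Lam (n : ℕ) (a b : ℝ) (s : Fin n → ℝ) : V n := (a • WithLp.toLp 2 s, b • WithLp.toLp 2 s)

def dirs (a b : ℝ) (i : Fin n) : V n := (a • EuclideanSpace.single i 1, b • EuclideanSpace.single i 1)

lemma Lam_update (a b : ℝ) (s : Fin n → ℝ) (i : Fin n) (y : ℝ) :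
    Lam n a b (Function.update s i y) = Lam n a b s + (y - s i) • dirs a b i := by
  unfold Lam dirs
  have : WithLp.toLp 2 (Function.update s i y)
      = WithLp.toLp 2 s + (y - s i) • (EuclideanSpace.single i (1 : ℝ) : E n) := by
    ext j
    simp only [PiLp.add_apply, PiLp.smul_apply, smul_eq_mul, EuclideanSpace.single,
      PiLp.single_apply, Function.update_apply]
    split_ifs with h
    · subst h; ring
    · ring
  rw [this]
  ext j <;> simp <;> ring_nf

lemma continuous_Lam (a b : ℝ) : Continuous (Lam n a b) := by
  unfold Lam; fun_prop

/-- iterated directional derivatives -/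
def dd (a b : ℝ) (l : List (Fin n)) (g : V n → ℝ) : V n → ℝ :=
  l.foldr (fun i h p => fderiv ℝ h p (dirs a b i)) g

lemma Sm.dir {g : V n → ℝ} (hg : Sm g) (e : V n) : Sm (fun p => fderiv ℝ g p e) :=
  ⟨contDiff_dir hg.smooth e, hcs_fderiv_apply hg.cpt (fun _ => e)⟩

lemma Sm.dd {g : V n → ℝ} (hg : Sm g) (a b : ℝ) (l : List (Fin n)) : Sm (dd a b l g) := by
  induction l with
  | nil => exact hg
  | cons i l ih => exact ih.dir _

lemma one_dir {g : V n → ℝ} (hg : Sm g) (p e : V n) (he : e ≠ 0) (s : ℝ) :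
    ‖g p‖ₑ ≤ ∫⁻ y : ℝ, ‖fderiv ℝ g (p + (y - s) • e) e‖ₑ := by
  set f : ℝ → ℝ := fun y => g (p + (y - s) • e) with hf
  have hfs : ContDiff ℝ 1 f := by
    have : ContDiff ℝ ∞ f := hg.smooth.comp (by fun_prop)
    exact this.of_le (by exact_mod_cast le_top)
  have hemb : Topology.IsClosedEmbedding (fun y : ℝ => p + (y - s) • e) := by
    have h1 : Topology.IsClosedEmbedding (fun y : ℝ => y • e) := isClosedEmbedding_smul_left he
    have h2 := ((Homeomorph.addLeft (p - s • e)).isClosedEmbedding).comp h1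
    convert h2 using 1
    ext y : 1
    simp [sub_smul]; abel
  have hfc : HasCompactSupport f := hg.cpt.comp_isClosedEmbedding hemb
  have h := hfc.enorm_le_lintegral_Ici_deriv hfs s
  have h0 : f s = g p := by simp [hf]
  rw [h0] at h
  refine h.trans ((setLIntegral_le_lintegral _ _).trans (le_of_eq ?_))
  congr 1
  ext y
  have hl : HasDerivAt (fun y : ℝ => p + (y - s) • e) e y := by
    simpa using (((hasDerivAt_id y).sub_const s).smul_const e).const_add p
  have hd := (hg.diff (p + (y - s) • e)).hasFDerivAt.comp_hasDerivAt y hl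
  rw [show deriv f y = _ from hd.deriv]

lemma marg (a b : ℝ) (hab : a ≠ 0) {g : V n → ℝ} (hg : Sm g) (p : V n) (l : List (Fin n))
    (hl : l.Nodup) (x : Fin n → ℝ) :
    ‖g (p + Lam n a b x)‖ₑ
      ≤ lmarginal (fun _ => (volume : Measure ℝ)) l.toFinset
          (fun s => ‖dd a b l g (p + Lam n a b s)‖ₑ) x := by
  induction l generalizing x with
  | nil => simp [dd]
  | cons i l ih =>
    rw [List.nodup_cons] at hl
    have hm : Measurable (fun s => ‖dd a b (i :: l) g (p + Lam n a b s)‖ₑ) := by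
      have h1 := (hg.dd a b (i :: l)).continuous
      have h2 := continuous_Lam (n := n) a b
      exact ((h1.comp (continuous_const.add h2)).enorm).measurable
    rw [List.toFinset_cons, lmarginal_insert' _ hm (by simpa using hl.1)]
    refine (ih hl.2 x).trans (lmarginal_mono (fun s => ?_) x)
    simp only [Lam_update]
    have he : dirs a b i ≠ 0 := by
      intro h
      have := congrArg (fun z : V n => z.1 i) h
      simp [dirs] at this
      exact hab this
    have := one_dir (hg.dd a b l) (p + Lam n a b s) (dirs a b i) he (s i)
    simpa only [dd, List.foldr_cons, add_assoc] using this

lemma point_le (a b : ℝ) (hab : a ≠ 0) {g : V n → ℝ} (hg : Sm g) (p : V n) :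
    ‖g p‖ₑ ≤ ∫⁻ s : E n, ‖dd a b (List.finRange n) g (p.1 + a • s, p.2 + b • s)‖ₑ := by
  have h := marg a b hab hg p (List.finRange n) (List.nodup_finRange n) 0
  have h0 : Lam n a b 0 = 0 := by simp [Lam]
  rw [h0, add_zero, List.toFinset_finRange, ← lintegral_eq_lmarginal_univ, ← volume_pi] at h
  refine h.trans (le_of_eq ?_)
  have := (EuclideanSpace.volume_preserving_symm_measurableEquiv_toLp (Fin n)).lintegral_comp_emb
     (MeasurableEquiv.measurableEmbedding _) (fun s : Fin n → ℝ => ‖dd a b (List.finRange n) g (p + Lam n a b s)‖ₑ)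
  rw [← this]
  rfl

def nrm (g : V n → ℝ) : ℝ≥0∞ := ∫⁻ p, ‖g p‖ₑ

lemma rho_le (a b : ℝ) (ha : 0 < a) {g : V n → ℝ} (hg : Sm g) (x : E n) :
    ∫⁻ v : E n, ‖g (x, v)‖ₑ ≤ ENNReal.ofReal (a ^ (-(n:ℝ))) * nrm (dd a b (List.finRange n) g) := by
  set G := dd a b (List.finRange n) g
  have hG : Sm G := hg.dd a b _
  have hGm : Measurable (fun p => ‖G p‖ₑ) := hG.continuous.enorm.measurable
  have h1 : ∫⁻ v : E n, ‖g (x, v)‖ₑ ≤ ∫⁻ v : E n, ∫⁻ s : E n, ‖G (x + a • s, v + b • s)‖ₑ :=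
    lintegral_mono fun v => point_le a b ha.ne' hg (x, v)
  refine h1.trans (le_of_eq ?_)
  rw [lintegral_lintegral_swap (by
    refine Measurable.aemeasurable ?_
    exact hGm.comp (by fun_prop))]
  have h2 : ∀ s : E n, ∫⁻ v : E n, ‖G (x + a • s, v + b • s)‖ₑ = ∫⁻ v : E n, ‖G (x + a • s, v)‖ₑ :=
    fun s => lintegral_add_right_eq_self (fun v => ‖G (x + a • s, v)‖ₑ) (b • s)
  simp only [h2]
  set H : E n → ℝ≥0∞ := fun y => ∫⁻ v : E n, ‖G (y, v)‖ₑ with hH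
  have hHm : Measurable H := hGm.lintegral_prod_right'
  have h3 : ∫⁻ s : E n, H (x + a • s) = ENNReal.ofReal (a ^ (-(n:ℝ))) * ∫⁻ y, H y := by
    have e1 := lintegral_add_left_eq_self H x (μ := volume)
    have e2 := Measure.map_addHaar_smul (volume : Measure (E n)) ha.ne'
    have e3 : ∫⁻ s : E n, H (x + a • s) = ∫⁻ y, H (x + y) ∂(Measure.map (a • ·) volume) := by
      rw [lintegral_map (by fun_prop) (by fun_prop)]
    rw [e3, e2, lintegral_smul_measure, e1]
    simp only [finrank_euclideanSpace, Fintype.card_fin, smul_eq_mul]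
    congr 2
    rw [abs_of_nonneg (by positivity), Real.rpow_neg ha.le, Real.rpow_natCast]
  have h4 : ∫⁻ y, H y = nrm G := by
    rw [nrm, Measure.volume_eq_prod, lintegral_prod _ hGm.aemeasurable]
  rw [h3, h4]

def KE (g : V n → ℝ) (p : V n) : ℝ≥0∞ := ∫⁻ q : V n, ‖kn (1 - n) q‖ₑ * ‖g (p - q)‖ₑ

/-- constant for the kernel near the origin. -/
def Cker (n : ℕ) : ℝ≥0∞ := ∫⁻ y in Metric.ball (0 : E n) 1, ‖‖y‖ ^ (1 - (n:ℝ))‖ₑ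

lemma Cker_lt_top (hn : 1 ≤ n) : Cker n < ⊤ :=
  (integrableOn_norm_rpow hn (a := 1 - n) (by linarith) one_pos).2

lemma ker_ball (hn : 1 ≤ n) {τ : ℝ} (hτ : 0 < τ) :
    ∫⁻ y in Metric.ball (0 : E n) τ, ‖‖y‖ ^ (1 - (n:ℝ))‖ₑ = ENNReal.ofReal τ * Cker n := by
  have e2 := Measure.map_addHaar_smul (volume : Measure (E n)) hτ.ne'
  set F : E n → ℝ≥0∞ := fun y => (Metric.ball (0 : E n) τ).indicator (fun y => ‖‖y‖ ^ (1 - (n:ℝ))‖ₑ) y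
  have hF : Measurable F := by
    refine Measurable.indicator ?_ measurableSet_ball
    fun_prop
  have e3 : ∫⁻ s : E n, F (τ • s) = ENNReal.ofReal (τ ^ (-(n:ℝ))) * ∫⁻ y, F y := by
    have e3 : ∫⁻ s : E n, F (τ • s) = ∫⁻ y, F y ∂(Measure.map (τ • ·) volume) := by
      rw [lintegral_map hF (by fun_prop)]
    rw [e3, e2, lintegral_smul_measure]
    simp only [finrank_euclideanSpace, Fintype.card_fin, smul_eq_mul]
    congr 2
    rw [abs_of_nonneg (by positivity), Real.rpow_neg hτ.le, Real.rpow_natCast]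
  have e4 : ∀ s : E n, F (τ • s) = ENNReal.ofReal (τ ^ (1 - (n:ℝ))) *
      (Metric.ball (0 : E n) 1).indicator (fun y => ‖‖y‖ ^ (1 - (n:ℝ))‖ₑ) s := by
    intro s
    have hns : ‖τ • s‖ = τ * ‖s‖ := by rw [norm_smul, Real.norm_eq_abs, abs_of_pos hτ]
    by_cases hs : ‖s‖ < 1
    · have h1 : τ • s ∈ Metric.ball (0 : E n) τ := by
        rw [mem_ball_zero_iff, hns]; nlinarith
      have h2 : s ∈ Metric.ball (0 : E n) 1 := by rwa [mem_ball_zero_iff]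
      simp only [F]
      rw [Set.indicator_of_mem h1, Set.indicator_of_mem h2, hns,
        Real.mul_rpow hτ.le (norm_nonneg _), enorm_mul, Real.enorm_of_nonneg (by positivity)]
    · have h1 : τ • s ∉ Metric.ball (0 : E n) τ := by
        rw [mem_ball_zero_iff, hns]; push Not at hs ⊢; nlinarith
      have h2 : s ∉ Metric.ball (0 : E n) 1 := by rwa [mem_ball_zero_iff]
      simp only [F]
      rw [Set.indicator_of_notMem h1, Set.indicator_of_notMem h2, mul_zero]
  rw [lintegral_congr e4] at e3
  rw [lintegral_const_mul _ (by
    refine Measurable.indicator ?_ measurableSet_ball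
    fun_prop), lintegral_indicator measurableSet_ball] at e3
  rw [lintegral_indicator measurableSet_ball] at e3
  have e5 : ENNReal.ofReal (τ ^ (n:ℝ)) * ENNReal.ofReal (τ ^ (-(n:ℝ))) = 1 := by
    rw [← ENNReal.ofReal_mul (by positivity), ← Real.rpow_add hτ]; simp
  have e6 : ENNReal.ofReal (τ ^ (n:ℝ)) * ENNReal.ofReal (τ ^ (1-(n:ℝ))) = ENNReal.ofReal τ := by
    rw [← ENNReal.ofReal_mul (by positivity), ← Real.rpow_add hτ]; simp
  rw [Cker, ← e6, mul_assoc, e3, ← mul_assoc, e5, one_mul]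

lemma KE_le (hn : 1 ≤ n) (τ b : ℝ) (hτ : 0 < τ) {g : V n → ℝ} (hg : Sm g) (p : V n) :
    KE g p ≤ (Cker n + 1) * ENNReal.ofReal (τ ^ (1-(n:ℝ)))
      * (nrm g + nrm (dd τ b (List.finRange n) g)) := by
  set G := dd τ b (List.finRange n) g
  set r : E n → ℝ≥0∞ := fun y => ∫⁻ v : E n, ‖g (y, v)‖ₑ with hr
  have hg0 : Measurable g := hg.continuous.measurable
  have hgm : Measurable (fun p => ‖g p‖ₑ) := hg.continuous.enorm.measurable
  have hrm : Measurable r := hgm.lintegral_prod_right'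
  have h1 : KE g p = ∫⁻ y : E n, ‖‖y‖ ^ (1 - (n:ℝ))‖ₑ * r (p.1 - y) := by
    rw [KE, Measure.volume_eq_prod, lintegral_prod _ (by
      refine Measurable.aemeasurable ?_
      exact ((measurable_kn _).enorm).mul (hgm.comp (by fun_prop)))]
    refine lintegral_congr fun y => ?_
    simp only [kn]
    rw [lintegral_const_mul _ (by fun_prop)]
    congr 1
    have := lintegral_sub_left_eq_self (μ := (volume : Measure (E n))) (fun v => ‖g (p.1 - y, v)‖ₑ) p.2
    exact this
  have hr1 : ∀ y, r y ≤ ENNReal.ofReal (τ ^ (-(n:ℝ))) * nrm G := fun y => rho_le τ b hτ hg y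
  have hr2 : ∫⁻ y, r (p.1 - y) = nrm g := by
    rw [lintegral_sub_left_eq_self (μ := (volume : Measure (E n))) r p.1]
    rw [nrm, Measure.volume_eq_prod, lintegral_prod _ hgm.aemeasurable]
  rw [h1, ← lintegral_add_compl _ (measurableSet_ball (x := (0 : E n)) (ε := τ))]
  have h2 : ∫⁻ y in Metric.ball (0 : E n) τ, ‖‖y‖ ^ (1 - (n:ℝ))‖ₑ * r (p.1 - y)
      ≤ Cker n * ENNReal.ofReal (τ ^ (1-(n:ℝ))) * nrm G := by
    calc _ ≤ ∫⁻ y in Metric.ball (0 : E n) τ, ‖‖y‖ ^ (1 - (n:ℝ))‖ₑ * (ENNReal.ofReal (τ ^ (-(n:ℝ))) * nrm G) := by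
          refine lintegral_mono fun y => ?_
          dsimp only
          gcongr
          exact hr1 _
      _ = _ := by
          rw [lintegral_mul_const _ (by fun_prop), ker_ball hn hτ]
          rw [show (1 - (n:ℝ)) = 1 + (-n) by ring, Real.rpow_add hτ, Real.rpow_one,
            ENNReal.ofReal_mul hτ.le]
          ring
  have h3 : ∫⁻ y in (Metric.ball (0 : E n) τ)ᶜ, ‖‖y‖ ^ (1 - (n:ℝ))‖ₑ * r (p.1 - y)
      ≤ ENNReal.ofReal (τ ^ (1-(n:ℝ))) * nrm g := by
    calc _ ≤ ∫⁻ y in (Metric.ball (0 : E n) τ)ᶜ, ENNReal.ofReal (τ ^ (1-(n:ℝ))) * r (p.1 - y) := by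
          refine setLIntegral_mono (by
            exact measurable_const.mul (hrm.comp (by fun_prop))) fun y hy => ?_
          gcongr
          rw [Real.enorm_of_nonneg (by positivity)]
          apply ENNReal.ofReal_le_ofReal
          have : τ ≤ ‖y‖ := by simpa using hy
          have hn' : (1:ℝ) ≤ n := by exact_mod_cast hn
          exact Real.rpow_le_rpow_of_nonpos hτ this (by linarith)
      _ ≤ ∫⁻ y, ENNReal.ofReal (τ ^ (1-(n:ℝ))) * r (p.1 - y) := setLIntegral_le_lintegral _ _
      _ = _ := by
          rw [lintegral_const_mul _ (by fun_prop), hr2]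
  refine (add_le_add h2 h3).trans ?_
  calc _ = ENNReal.ofReal (τ ^ (1-(n:ℝ))) * (Cker n * nrm G + 1 * nrm g) := by ring
    _ ≤ ENNReal.ofReal (τ ^ (1-(n:ℝ))) * ((Cker n + 1) * nrm G + (Cker n + 1) * nrm g) := by
        gcongr
        · exact le_self_add
        · exact le_add_self
    _ = _ := by ring

lemma KE_symm {g h : V n → ℝ} (hg : Sm g) (hh : Sm h) :
    ∫⁻ p, KE g p * ‖h p‖ₑ = ∫⁻ p, KE h p * ‖g p‖ₑ := by
  have hg0 : Measurable g := hg.continuous.measurable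
  have hgm : Measurable (fun p => ‖g p‖ₑ) := hg.continuous.enorm.measurable
  have hh0 : Measurable h := hh.continuous.measurable
  have hhm : Measurable (fun p => ‖h p‖ₑ) := hh.continuous.enorm.measurable
  have hk0 : Measurable (kn (1 - n) : V n → ℝ) := measurable_kn _
  have hkm : Measurable (fun q : V n => ‖kn (1 - n) q‖ₑ) := (measurable_kn _).enorm
  have e1 : ∀ p, KE g p * ‖h p‖ₑ = ∫⁻ q, ‖kn (1 - n) q‖ₑ * ‖g (p - q)‖ₑ * ‖h p‖ₑ := fun p => by
    rw [KE, lintegral_mul_const _ (by fun_prop)]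
  have e2 : ∀ p, KE h p * ‖g p‖ₑ = ∫⁻ q, ‖kn (1 - n) q‖ₑ * ‖g p‖ₑ * ‖h (p + q)‖ₑ := fun p => by
    rw [KE, ← lintegral_mul_const _ (by fun_prop)]
    have hneg : (volume : Measure (V n)).IsNegInvariant :=
      Measure.IsAddHaarMeasure.isNegInvariant_of_regular _
    rw [← lintegral_neg_eq_self]
    refine lintegral_congr fun q => ?_
    simp only [kn, Prod.fst_neg, norm_neg, sub_neg_eq_add]
    ring
  simp only [e1, e2]
  have s1 : ∫⁻ p : V n, ∫⁻ q : V n, ‖kn (1 - n) q‖ₑ * ‖g (p - q)‖ₑ * ‖h p‖ₑ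
      = ∫⁻ q : V n, ∫⁻ p : V n, ‖kn (1 - n) q‖ₑ * ‖g (p - q)‖ₑ * ‖h p‖ₑ :=
    lintegral_lintegral_swap (Measurable.aemeasurable (by
      simp only [Function.uncurry_def]; fun_prop))
  have s2 : ∫⁻ p : V n, ∫⁻ q : V n, ‖kn (1 - n) q‖ₑ * ‖g p‖ₑ * ‖h (p + q)‖ₑ
      = ∫⁻ q : V n, ∫⁻ p : V n, ‖kn (1 - n) q‖ₑ * ‖g p‖ₑ * ‖h (p + q)‖ₑ :=
    lintegral_lintegral_swap (Measurable.aemeasurable (by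
      simp only [Function.uncurry_def]; fun_prop))
  rw [s1, s2]
  refine lintegral_congr fun q => ?_
  rw [← lintegral_add_right_eq_self (fun p => ‖kn (1 - n) q‖ₑ * ‖g (p - q)‖ₑ * ‖h p‖ₑ) q]
  simp

lemma KE_int_le {g h : V n → ℝ} (hh : Sm h) {M : ℝ≥0∞} (hM : ∀ p, KE g p ≤ M) :
    ∫⁻ p, KE g p * ‖h p‖ₑ ≤ M * nrm h := by
  have hh0 : Measurable h := hh.continuous.measurable
  have hhm : Measurable (fun p => ‖h p‖ₑ) := hh.continuous.enorm.measurable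
  rw [nrm, ← lintegral_const_mul _ hhm]
  exact lintegral_mono fun p => by
    dsimp only
    gcongr
    exact hM p

lemma grad_le_KE (hn : 3 ≤ n) {g : V n → ℝ} (hg : Sm g) (p e : V n) :
    ‖fderiv ℝ (Phi g) p e‖ₑ ≤ n * ‖e.1‖ₑ * KE g p := by
  have h := grad_Phi_le hn hg p e
  have h2 : ENNReal.ofReal (∫ q : V n, kn (1 - n) q * |g (p - q)|) ≤ KE g p := by
    refine (Real.ofReal_le_enorm _).trans ((enorm_integral_le_lintegral_enorm _).trans ?_)
    refine lintegral_mono fun q => ?_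
    simp [enorm_mul]
  rw [← ofReal_norm_eq_enorm, Real.norm_eq_abs]
  refine (ENNReal.ofReal_le_ofReal h).trans ?_
  rw [ENNReal.ofReal_mul (by positivity), ENNReal.ofReal_mul (by positivity), ENNReal.ofReal_natCast,
    ofReal_norm_eq_enorm]
  gcongr

end VP

namespace VP
open scoped ContDiff ENNReal

def bt (t : ℝ) : ℝ := if t ≤ 1 then 0 else 1

/-- the `n` fields used in the Sobolev inequality -/
def Lt (n : ℕ) (t : ℝ) : List (VFIdx n) :=
  (List.finRange n).map fun i => if t ≤ 1 then Sum.inl i else Sum.inr (Sum.inl i)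

lemma length_Lt (t : ℝ) : (Lt n t).length = n := by simp [Lt]

lemma DL_append (t : ℝ) (L₁ L₂ : List (VFIdx n)) (g : V n → ℝ) :
    DL t (L₁ ++ L₂) g = DL t L₁ (DL t L₂ g) := by simp [DL, List.foldr_append]

lemma X_inl (t : ℝ) (i : Fin n) (p : V n) : X (Sum.inl i) t p = (EuclideanSpace.single i 1, 0) := by
  have : AA (Sum.inl i) p = 0 := rfl
  rw [X, this]; simp [va, vb]

lemma X_inr (t : ℝ) (i : Fin n) (p : V n) : X (Sum.inr (Sum.inl i)) t p
    = (t • EuclideanSpace.single i 1, EuclideanSpace.single i 1) := by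
  have : AA (Sum.inr (Sum.inl i)) p = 0 := rfl
  rw [X, this]; simp [va, vb]

lemma dd_eq (t : ℝ) (g : V n → ℝ) :
    dd (max 1 t) (bt t) (List.finRange n) g = DL t (Lt n t) g := by
  unfold dd DL Lt
  rw [List.foldr_map]
  congr 1
  ext i h p
  by_cases ht : t ≤ 1
  · simp [ht, D, X_inl, dirs, bt]
  · simp only [ht, if_false, D, X_inr, dirs, bt]
    rw [max_eq_right (by linarith)]
    simp

lemma nrm_eq {g : V n → ℝ} (hg : Sm g) : nrm g = ENNReal.ofReal (∫ p, |g p|) :=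
  (ofReal_integral_norm_eq_lintegral_enorm hg.integrable).symm

/-- the energy on phase space -/
def En (N : ℕ) (t : ℝ) (g : V n → ℝ) : ℝ :=
  ∑ m ∈ Finset.range (N+1), ∑ α : Fin m → VFIdx n, ∫ p : V n, |DL t (List.ofFn α) g p|

lemma En_nonneg (N : ℕ) (t : ℝ) (g : V n → ℝ) : 0 ≤ En N t g :=
  Finset.sum_nonneg fun _ _ => Finset.sum_nonneg fun _ _ => integral_nonneg fun _ => abs_nonneg _

lemma le_En {N : ℕ} (t : ℝ) (g : V n → ℝ) (L : List (VFIdx n)) (hL : L.length ≤ N) :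
    ∫ p : V n, |DL t L g p| ≤ En N t g := by
  have h1 : ∫ p : V n, |DL t L g p| ≤ ∑ α : Fin L.length → VFIdx n, ∫ p : V n, |DL t (List.ofFn α) g p| := by
    have := Finset.single_le_sum (s := Finset.univ)
      (f := fun α : Fin L.length → VFIdx n => ∫ p : V n, |DL t (List.ofFn α) g p|)
      (fun _ _ => integral_nonneg fun _ => abs_nonneg _) (Finset.mem_univ L.get)
    simpa only [List.ofFn_get] using this
  refine h1.trans ?_
  exact Finset.single_le_sum (s := Finset.range (N+1))
      (f := fun m => ∑ α : Fin m → VFIdx n, ∫ p : V n, |DL t (List.ofFn α) g p|)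
      (fun _ _ => Finset.sum_nonneg fun _ _ => integral_nonneg fun _ => abs_nonneg _)
      (Finset.mem_range.2 (by omega))

lemma nrm_le_En {N : ℕ} (t : ℝ) {g : V n → ℝ} (hg : Sm g) (L : List (VFIdx n)) (hL : L.length ≤ N) :
    nrm (DL t L g) ≤ ENNReal.ofReal (En N t g) := by
  rw [nrm_eq (hg.DL t L)]
  exact ENNReal.ofReal_le_ofReal (le_En t g L hL)

def CK (n : ℕ) : ℝ := (Cker n).toReal + 1

lemma CK_pos : 0 < CK n := by unfold CK; positivity

lemma CK_eq (hn : 1 ≤ n) : Cker n + 1 = ENNReal.ofReal (CK n) := by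
  unfold CK
  rw [ENNReal.ofReal_add (by positivity) zero_le_one, ENNReal.ofReal_toReal (Cker_lt_top hn).ne]
  simp

lemma KE_le_En (hn : 1 ≤ n) {N : ℕ} (t : ℝ) {f : V n → ℝ} (hf : Sm f) (γ : List (VFIdx n))
    (hγ : γ.length + n ≤ N) (p : V n) :
    KE (DL t γ f) p ≤ ENNReal.ofReal (CK n * (max 1 t) ^ (1 - (n:ℝ)) * (2 * En N t f)) := by
  have hτ : 0 < max 1 t := lt_of_lt_of_le one_pos (le_max_left _ _)
  have h := KE_le hn (max 1 t) (bt t) hτ (hf.DL t γ) p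
  rw [dd_eq, ← DL_append] at h
  refine h.trans ?_
  have h1 := nrm_le_En (N := N) t hf γ (by omega)
  have h2 := nrm_le_En (N := N) t hf (Lt n t ++ γ) (by simp [length_Lt]; omega)
  rw [CK_eq hn, ← ENNReal.ofReal_mul CK_pos.le,
    ENNReal.ofReal_mul (mul_nonneg CK_pos.le (by positivity)), two_mul,
    ENNReal.ofReal_add (En_nonneg _ _ _) (En_nonneg _ _ _)]
  gcongr

lemma pair_le (hn : 1 ≤ n) {N : ℕ} (t : ℝ) {f : V n → ℝ} (hf : Sm f) (γ β : List (VFIdx n))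
    (h1 : γ.length ≤ N) (h2 : β.length ≤ N) (h : γ.length + n ≤ N ∨ β.length + n ≤ N) :
    ∫⁻ p, KE (DL t γ f) p * ‖DL t β f p‖ₑ
      ≤ ENNReal.ofReal (CK n * (max 1 t) ^ (1 - (n:ℝ)) * (2 * En N t f ^ 2)) := by
  have key : ∀ γ β : List (VFIdx n), β.length ≤ N → γ.length + n ≤ N →
      ∫⁻ p, KE (DL t γ f) p * ‖DL t β f p‖ₑ
      ≤ ENNReal.ofReal (CK n * (max 1 t) ^ (1 - (n:ℝ)) * (2 * En N t f ^ 2)) := by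
    intro γ β h2 h3
    refine (KE_int_le (hf.DL t β) (KE_le_En hn t hf γ h3)).trans ?_
    have h4 := nrm_le_En (N := N) t hf β h2
    refine (mul_le_mul_right h4 _).trans (le_of_eq ?_)
    rw [← ENNReal.ofReal_mul]
    · congr 1; ring
    · have := CK_pos (n := n)
      have := En_nonneg N t f
      positivity
  rcases h with h | h
  · exact key γ β h2 h
  · rw [KE_symm (hf.DL t γ) (hf.DL t β)]
    exact key β γ h1 h

lemma grad_bound (hn : 3 ≤ n) {N : ℕ} (hN : n ≤ N) (t : ℝ) {f : V n → ℝ} (hf : Sm f) (p e : V n) :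
    |fderiv ℝ (Phi f) p e| ≤ n * ‖e.1‖ * (CK n * (2 * En N t f)) := by
  have h := grad_le_KE hn hf p e
  have h2 := KE_le_En (N := N) (by omega) t hf [] (by simpa using hN) p
  rw [DL_nil] at h2
  have h3 : ‖fderiv ℝ (Phi f) p e‖ₑ ≤ ENNReal.ofReal (n * ‖e.1‖ * (CK n * (max 1 t) ^ (1 - (n:ℝ)) * (2 * En N t f))) := by
    refine h.trans ?_
    rw [ENNReal.ofReal_mul (by positivity), ENNReal.ofReal_mul (by positivity), ENNReal.ofReal_natCast,
      ofReal_norm_eq_enorm]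
    gcongr
  have hE := En_nonneg N t f
  have hC := CK_pos (n := n)
  rw [← ofReal_norm_eq_enorm, ENNReal.ofReal_le_ofReal_iff (by positivity)] at h3
  refine h3.trans ?_
  have hnR : (3 : ℝ) ≤ n := by exact_mod_cast hn
  have : (max 1 t) ^ (1 - (n:ℝ)) ≤ 1 :=
    Real.rpow_le_one_of_one_le_of_nonpos (le_max_left _ _) (by linarith)
  gcongr
  exact mul_le_of_le_one_right hC.le this

lemma hcs_B {g h : V n → ℝ} (hh : Sm h) : HasCompactSupport (B g h) := by
  unfold B
  rw [show (fun p => ∑ i, fderiv ℝ (Phi g) p (EuclideanSpace.single i 1, 0)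
      * fderiv ℝ h p (0, EuclideanSpace.single i 1)) =
      ∑ i, fun p => fderiv ℝ (Phi g) p (EuclideanSpace.single i 1, 0)
      * fderiv ℝ h p (0, EuclideanSpace.single i 1) by ext p; simp]
  refine Finset.sum_induction _ HasCompactSupport (fun a b ha hb => ha.add hb) ?_ ?_
  · exact HasCompactSupport.zero
  · intro i _
    exact HasCompactSupport.mul_left (hh.dir _).cpt

lemma Sm_B (hn : 3 ≤ n) {g h : V n → ℝ} (hg : Sm g) (hh : Sm h) : Sm (B g h) :=
  ⟨contDiff_B hn hg hh, hcs_B hh⟩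

lemma Sm_evalT (hn : 3 ≤ n) {f : V n → ℝ} (hf : Sm f) (t : ℝ) (T : List (Trm n)) :
    Sm (evalT t f T) := by
  refine ⟨contDiff_evalT hn hf t T, ?_⟩
  induction T with
  | nil =>
    have h : evalT t f ([] : List (Trm n)) = 0 := by ext p; simp [evalT]
    rw [h]; exact HasCompactSupport.zero
  | cons τ T ih =>
    have : evalT t f (τ :: T) = (fun p => τ.1 * B (DL t τ.2.1 f) (DL t τ.2.2 f) p) + evalT t f T := by
      ext p; exact evalT_cons t f τ T p
    rw [this]
    exact (HasCompactSupport.mul_left (hcs_B (hf.DL t _))).add ih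

lemma vder_eq (t : ℝ) (h : V n → ℝ) (p : V n) (i : Fin n) :
    fderiv ℝ h p (0, EuclideanSpace.single i 1)
      = D t (Sum.inr (Sum.inl i)) h p - t * D t (Sum.inl i) h p := by
  simp only [D, X_inr, X_inl]
  have : ((0 : E n), EuclideanSpace.single i (1:ℝ)) = (t • EuclideanSpace.single i (1:ℝ), EuclideanSpace.single i (1:ℝ)) - t • (EuclideanSpace.single i (1:ℝ), (0 : E n)) := by
    ext <;> simp
  rw [this, map_sub, map_smul, smul_eq_mul]

lemma B_le (hn : 3 ≤ n) {N : ℕ} (hN : 2 * n ≤ N) {t : ℝ} (ht : 0 ≤ t) {f : V n → ℝ} (hf : Sm f)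
    (γ β : List (VFIdx n)) (h1 : γ.length + β.length ≤ N) (h2 : β.length + 1 ≤ N) :
    ∫ p, |B (DL t γ f) (DL t β f) p|
      ≤ n * (n * (1 + t) * (CK n * (max 1 t) ^ (1 - (n:ℝ)) * (2 * En N t f ^ 2))) := by
  set g := DL t γ f
  set h := DL t β f
  set Q := CK n * (max 1 t) ^ (1 - (n:ℝ)) * (2 * En N t f ^ 2) with hQ
  have hg : Sm g := hf.DL t γ
  have hh : Sm h := hf.DL t β
  have hQ0 : 0 ≤ Q := by
    have hE := En_nonneg N t f
    have hC := CK_pos (n := n)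
    positivity
  have key : ∀ i : Fin n, ∫⁻ p, ‖fderiv ℝ (Phi g) p (EuclideanSpace.single i 1, 0)
      * fderiv ℝ h p (0, EuclideanSpace.single i 1)‖ₑ ≤ ENNReal.ofReal (n * (1 + t) * Q) := by
    intro i
    have hm1 : Measurable (fun p => ‖D t (Sum.inr (Sum.inl i)) h p‖ₑ) := (hh.D t _).continuous.enorm.measurable
    have hm2 : Measurable (fun p => ‖D t (Sum.inl i) h p‖ₑ) := (hh.D t _).continuous.enorm.measurable
    have hg0 : Measurable g := hg.continuous.measurable
    have hk0 : Measurable (kn (1 - n) : V n → ℝ) := measurable_kn _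
    have hKm : Measurable (KE g) := by
      unfold KE
      exact Measurable.lintegral_prod_right' (f := fun z : V n × V n => ‖kn (1 - n) z.2‖ₑ * ‖g (z.1 - z.2)‖ₑ) (by fun_prop)
    have hp1 := pair_le (N := N) (by omega) t hf γ (Sum.inr (Sum.inl i) :: β) (by omega)
      (by simpa using h2) (by simp; omega)
    have hp2 := pair_le (N := N) (by omega) t hf γ (Sum.inl i :: β) (by omega)
      (by simpa using h2) (by simp; omega)
    rw [DL_cons] at hp1 hp2
    calc _ ≤ ∫⁻ p, (n * (KE g p * ‖D t (Sum.inr (Sum.inl i)) h p‖ₑ)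
            + n * ENNReal.ofReal t * (KE g p * ‖D t (Sum.inl i) h p‖ₑ)) := by
          refine lintegral_mono fun p => ?_
          dsimp only
          rw [enorm_mul]
          have e1 := grad_le_KE hn hg p (EuclideanSpace.single i 1, 0)
          have e2 : ‖(EuclideanSpace.single i (1:ℝ) : E n)‖ₑ = 1 := by
            rw [← ofReal_norm_eq_enorm]; simp
          simp only [e2, mul_one] at e1
          have e3 : ‖fderiv ℝ h p (0, EuclideanSpace.single i 1)‖ₑ ≤
              ‖D t (Sum.inr (Sum.inl i)) h p‖ₑ + ENNReal.ofReal t * ‖D t (Sum.inl i) h p‖ₑ := by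
            rw [vder_eq t]
            refine (enorm_sub_le).trans ?_
            rw [enorm_mul, Real.enorm_of_nonneg ht]
          refine (mul_le_mul' e1 e3).trans (le_of_eq ?_)
          ring
      _ = n * (∫⁻ p, KE g p * ‖D t (Sum.inr (Sum.inl i)) h p‖ₑ)
            + n * ENNReal.ofReal t * ∫⁻ p, KE g p * ‖D t (Sum.inl i) h p‖ₑ := by
          rw [lintegral_add_left (by fun_prop), lintegral_const_mul _ (by fun_prop),
            lintegral_const_mul _ (by fun_prop)]
      _ ≤ n * ENNReal.ofReal Q + n * ENNReal.ofReal t * ENNReal.ofReal Q := by gcongr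
      _ = _ := by
          rw [ENNReal.ofReal_mul (by positivity : 0 ≤ (n:ℝ) * (1 + t)),
            ENNReal.ofReal_mul (by positivity : 0 ≤ (n:ℝ)), ENNReal.ofReal_add zero_le_one ht, ENNReal.ofReal_natCast]
          simp; ring
  have h3 : ENNReal.ofReal (∫ p, |B g h p|) ≤ ENNReal.ofReal (n * (n * (1 + t) * Q)) := by
    have hB := Sm_B hn hg hh
    rw [← nrm_eq hB, nrm]
    calc _ ≤ ∫⁻ p, ∑ i, ‖fderiv ℝ (Phi g) p (EuclideanSpace.single i 1, 0)
      * fderiv ℝ h p (0, EuclideanSpace.single i 1)‖ₑ := lintegral_mono fun p => enorm_sum_le _ _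
      _ = ∑ i, ∫⁻ p, ‖fderiv ℝ (Phi g) p (EuclideanSpace.single i 1, 0)
      * fderiv ℝ h p (0, EuclideanSpace.single i 1)‖ₑ := by
          refine lintegral_finsetSum _ fun i _ => ?_
          exact (((contDiff_dir (contDiff_Phi hn hg) _).continuous.mul
            (contDiff_dir hh.smooth _).continuous).enorm).measurable
      _ ≤ ∑ i : Fin n, ENNReal.ofReal (n * (1 + t) * Q) := Finset.sum_le_sum fun i _ => key i
      _ = _ := by
          rw [ENNReal.ofReal_mul (by positivity : (0:ℝ) ≤ n)]; simp
  rwa [ENNReal.ofReal_le_ofReal_iff (by positivity)] at h3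

lemma decay (hn : 4 ≤ n) {t : ℝ} (ht : 0 ≤ t) :
    (1 + t) * (max 1 t) ^ (1 - (n:ℝ)) ≤ 8 * ((1 + t) ^ 2)⁻¹ := by
  have hnR : (4 : ℝ) ≤ n := by exact_mod_cast hn
  set τ := max 1 t
  have h1 : 1 ≤ τ := le_max_left _ _
  have h2 : t ≤ τ := le_max_right _ _
  have h3 : τ ^ (1 - (n:ℝ)) ≤ τ ^ (-3 : ℝ) := Real.rpow_le_rpow_of_exponent_le h1 (by linarith)
  have h4 : τ ^ (-3 : ℝ) = (τ ^ 3)⁻¹ := by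
    rw [Real.rpow_neg (by linarith)]; norm_cast
  rw [h4] at h3
  have h5 : (1 + t) ^ 3 ≤ (2 * τ) ^ 3 := by
    apply pow_le_pow_left₀ (by linarith); linarith
  calc (1 + t) * τ ^ (1 - (n:ℝ)) ≤ (1 + t) * (τ ^ 3)⁻¹ := by gcongr
    _ ≤ 8 * ((1 + t) ^ 2)⁻¹ := by
      rw [← div_eq_mul_inv, ← div_eq_mul_inv, div_le_div_iff₀ (by positivity) (by positivity)]
      nlinarith

lemma evalT_le (hn : 4 ≤ n) {N : ℕ} (hN : 2 * n ≤ N) (T : List (Trm n))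
    (hT : ∀ τ ∈ T, τ.2.1.length + τ.2.2.length ≤ N ∧ τ.2.2.length + 1 ≤ N) :
    ∃ C : ℝ, 0 ≤ C ∧ ∀ t : ℝ, 0 ≤ t → ∀ f : V n → ℝ, Sm f →
      ∫ p, |evalT t f T p| ≤ C * ((1 + t) ^ 2)⁻¹ * En N t f ^ 2 := by
  have hn3 : 3 ≤ n := by omega
  induction T with
  | nil => exact ⟨0, le_rfl, fun t ht f hf => by simp [evalT]⟩
  | cons τ T ih =>
    obtain ⟨C, hC, h⟩ := ih (fun τ' h' => hT τ' (List.mem_cons_of_mem _ h'))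
    refine ⟨|τ.1| * (n * (n * (CK n * 16))) + C, by have := CK_pos (n := n); positivity, fun t ht f hf => ?_⟩
    have hB := B_le hn3 hN ht hf τ.2.1 τ.2.2 (hT τ (by simp)).1 (hT τ (by simp)).2
    have hS1 := Sm_B hn3 (hf.DL t τ.2.1) (hf.DL t τ.2.2)
    have hS2 := Sm_evalT hn3 hf t T
    calc ∫ p, |evalT t f (τ :: T) p|
        ≤ ∫ p, (|τ.1| * |B (DL t τ.2.1 f) (DL t τ.2.2 f) p| + |evalT t f T p|) := by
          refine integral_mono (Sm_evalT hn3 hf t _).integrable.abs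
            ((hS1.integrable.abs.const_mul _).add hS2.integrable.abs) fun p => ?_
          dsimp only
          rw [evalT_cons, ← abs_mul]
          exact abs_add_le _ _
      _ = |τ.1| * (∫ p, |B (DL t τ.2.1 f) (DL t τ.2.2 f) p|) + ∫ p, |evalT t f T p| := by
          rw [integral_add (hS1.integrable.abs.const_mul _) hS2.integrable.abs, integral_const_mul]
      _ ≤ |τ.1| * (n * (n * (CK n * 16)) * ((1 + t) ^ 2)⁻¹ * En N t f ^ 2) + C * ((1 + t) ^ 2)⁻¹ * En N t f ^ 2 := by
          gcongr
          · refine hB.trans ?_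
            have := decay hn ht
            have hE := sq_nonneg (En N t f)
            have hCK := CK_pos (n := n)
            calc _ = n * (n * (CK n * 2)) * En N t f ^ 2 * ((1 + t) * (max 1 t) ^ (1 - (n:ℝ))) := by ring
              _ ≤ n * (n * (CK n * 2)) * En N t f ^ 2 * (8 * ((1 + t) ^ 2)⁻¹) := by gcongr
              _ = _ := by ring
          · exact h t ht f hf
      _ = _ := by ring

lemma evalT_Terms_le (hn : 4 ≤ n) {N : ℕ} (hN : 2 * n ≤ N) (L : List (VFIdx n)) (hL : L.length ≤ N) :
    ∃ C : ℝ, 0 ≤ C ∧ ∀ t : ℝ, 0 ≤ t → ∀ f : V n → ℝ, Sm f →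
      ∫ p, |evalT t f (Terms L) p| ≤ C * ((1 + t) ^ 2)⁻¹ * En N t f ^ 2 :=
  evalT_le hn hN _ fun τ hτ => by have := Terms_len L τ hτ; omega

end VP

namespace VP
open scoped ContDiff

lemma Phi_eq (hn : 3 ≤ n) {g : V n → ℝ} (hg : Sm g) (p : V n) :
    Phi g p = ∫ y : E n, ‖p.1 - y‖ ^ ((2 : ℝ) - n) * ∫ v : E n, g (y, v) := by
  have hinteg : Integrable (fun q => kn (2 - n) q * g (p - q)) :=
    integrable_kn_mul (by omega) (two_sub_gt hn) (hg.reflect p).continuous (hg.reflect p).cpt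
  haveI hneg : (volume : Measure (V n)).IsNegInvariant :=
    Measure.IsAddHaarMeasure.isNegInvariant_of_regular _
  have h1 : Phi g p = ∫ q : V n, kn (2 - n) (p - q) * g q := by
    unfold Phi
    rw [← integral_sub_left_eq_self (μ := (volume : Measure (V n))) (fun q => kn (2 - n) q * g (p - q)) p]
    simp
  have hint2 : Integrable (fun q => kn (2 - n) (p - q) * g q) := by
    have := hinteg.comp_sub_left p
    simpa using this
  rw [h1, Measure.volume_eq_prod, integral_prod _ hint2]
  refine integral_congr_ae (Filter.Eventually.of_forall fun y => ?_)
  simp only [kn, Prod.fst_sub]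
  rw [integral_const_mul]

lemma Phi_indep (hn : 3 ≤ n) {g : V n → ℝ} (hg : Sm g) (x v w : E n) :
    Phi g (x, v) = Phi g (x, w) := by
  rw [Phi_eq hn hg, Phi_eq hn hg]

abbrev U (n : ℕ) : Type := ℝ × V n

def DU (Z : VFIdx n) (G : U n → ℝ) (u : U n) : ℝ := fderiv ℝ G u (0, X Z u.1 u.2)

def DUL (L : List (VFIdx n)) (G : U n → ℝ) : U n → ℝ := L.foldr DU G

def Y0 (u : U n) : U n := (1, (u.2.2, 0))

def TT (G : U n → ℝ) (u : U n) : ℝ := fderiv ℝ G u (Y0 u)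

lemma fderiv_slice {G : U n → ℝ} (hG : Differentiable ℝ G) (t : ℝ) (p e : V n) :
    fderiv ℝ (fun p => G (t, p)) p e = fderiv ℝ G (t, p) (0, e) := by
  have h : HasFDerivAt (fun p : V n => G (t, p))
      ((fderiv ℝ G (t, p)).comp (ContinuousLinearMap.inr ℝ ℝ (V n))) p :=
    (hG (t, p)).hasFDerivAt.comp p (hasFDerivAt_prodMk_right t p)
  rw [h.fderiv]; simp

lemma deriv_slice {G : U n → ℝ} (hG : Differentiable ℝ G) (t : ℝ) (p : V n) :
    HasDerivAt (fun s => G (s, p)) (fderiv ℝ G (t, p) (1, 0)) t := by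
  have h : HasFDerivAt (fun s : ℝ => G (s, p))
      ((fderiv ℝ G (t, p)).comp (ContinuousLinearMap.inl ℝ ℝ (V n))) t :=
    (hG (t, p)).hasFDerivAt.comp t (hasFDerivAt_prodMk_left t p)
  have := h.hasDerivAt
  simpa using this

lemma contDiff_X' (Z : VFIdx n) : ContDiff ℝ ∞ (fun u : U n => ((0 : ℝ), X Z u.1 u.2)) := by
  unfold X; fun_prop

lemma contDiff_Y0 : ContDiff ℝ ∞ (Y0 : U n → U n) := by unfold Y0; fun_prop

lemma contDiff_DU {G : U n → ℝ} (hG : ContDiff ℝ ∞ G) (Z : VFIdx n) : ContDiff ℝ ∞ (DU Z G) := by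
  unfold DU
  exact (hG.fderiv_right (m := ∞) le_rfl).clm_apply (contDiff_X' Z)

lemma contDiff_TT {G : U n → ℝ} (hG : ContDiff ℝ ∞ G) : ContDiff ℝ ∞ (TT G) := by
  unfold TT
  exact (hG.fderiv_right (m := ∞) le_rfl).clm_apply contDiff_Y0

lemma contDiff_DUL {G : U n → ℝ} (hG : ContDiff ℝ ∞ G) (L : List (VFIdx n)) :
    ContDiff ℝ ∞ (DUL L G) := by
  induction L with
  | nil => exact hG
  | cons Z L ih => exact contDiff_DU ih Z

lemma DUL_slice {G : U n → ℝ} (hG : ContDiff ℝ ∞ G) (L : List (VFIdx n)) (t : ℝ) (p : V n) :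
    DUL L G (t, p) = DL t L (fun p => G (t, p)) p := by
  induction L generalizing p with
  | nil => rfl
  | cons Z L ih =>
    have h : DL t L (fun p => G (t, p)) = fun p => DUL L G (t, p) := by ext p; exact (ih p).symm
    rw [DL_cons, h, D, fderiv_slice ((contDiff_DUL hG L).differentiable (by simp))]
    rfl

def Y0L (n : ℕ) : U n →L[ℝ] U n :=
  ContinuousLinearMap.prod 0 (ContinuousLinearMap.prod
    ((ContinuousLinearMap.snd ℝ (E n) (E n)).comp (ContinuousLinearMap.snd ℝ ℝ (V n))) 0)

lemma hasFDerivAt_Y0 (u : U n) : HasFDerivAt Y0 (Y0L n) u := by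
  have : (Y0 : U n → U n) = fun u => ((1 : ℝ), (0 : V n)) + Y0L n u := by
    ext u : 1; simp [Y0, Y0L]
  rw [this]
  exact (Y0L n).hasFDerivAt.const_add _

def XL (Z : VFIdx n) : U n →L[ℝ] U n :=
  ContinuousLinearMap.prod 0 ((ContinuousLinearMap.fst ℝ ℝ (V n)).smulRight ((vb Z, 0) : V n)
    + (AA Z).comp (ContinuousLinearMap.snd ℝ ℝ (V n)))

lemma hasFDerivAt_XU (Z : VFIdx n) (u : U n) :
    HasFDerivAt (fun u : U n => ((0 : ℝ), X Z u.1 u.2)) (XL Z) u := by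
  have : (fun u : U n => ((0 : ℝ), X Z u.1 u.2)) = fun u => ((0 : ℝ), ((va Z, vb Z) : V n)) + XL Z u := by
    ext u : 1
    simp only [X, XL, ContinuousLinearMap.prod_apply, zero_apply, add_apply,
      ContinuousLinearMap.smulRight_apply, ContinuousLinearMap.coe_fst', ContinuousLinearMap.comp_apply,
      ContinuousLinearMap.coe_snd', Prod.mk_add_mk, zero_add, Prod.smul_mk, smul_zero]
    rw [← add_assoc]
    congr 2
    ext <;> simp
  rw [this]
  exact (XL Z).hasFDerivAt.const_add _

lemma TT_DU {G : U n → ℝ} (hG : ContDiff ℝ ∞ G) (Z : VFIdx n) (u : U n) :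
    TT (DU Z G) u = DU Z (TT G) u := by
  have h1 := (hasFDerivAt_dir hG (hasFDerivAt_XU Z u)).fderiv
  have h2 := (hasFDerivAt_dir hG (hasFDerivAt_Y0 u)).fderiv
  have e1 : TT (DU Z G) u = fderiv ℝ (fun u => fderiv ℝ G u (0, X Z u.1 u.2)) u (Y0 u) := rfl
  have e2 : DU Z (TT G) u = fderiv ℝ (fun u => fderiv ℝ G u (Y0 u)) u (0, X Z u.1 u.2) := rfl
  rw [e1, e2, h1, h2]
  simp only [add_apply, ContinuousLinearMap.comp_apply, ContinuousLinearMap.flip_apply]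
  rw [snd_symm hG u (Y0 u)]
  congr 2
  simp [XL, Y0L, Y0, X, AA]

lemma TT_DUL {G : U n → ℝ} (hG : ContDiff ℝ ∞ G) (L : List (VFIdx n)) :
    TT (DUL L G) = DUL L (TT G) := by
  induction L with
  | nil => rfl
  | cons Z L ih =>
    ext u
    have := TT_DU (contDiff_DUL hG L) Z u
    rw [ih] at this
    exact this

lemma DL_const_mul {P : V n → ℝ} (hP : ContDiff ℝ ∞ P) (c : ℝ) (t : ℝ) (L : List (VFIdx n)) (p : V n) :
    DL t L (fun p => c * P p) p = c * DL t L P p := by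
  induction L generalizing p with
  | nil => rfl
  | cons Z L ih =>
    have : DL t L (fun p => c * P p) = fun p => c * DL t L P p := by ext p; exact ih p
    rw [DL_cons, this, D_const_mul ((contDiff_DL hP t L).differentiable (by simp))]; rfl

lemma TT_eq {G : U n → ℝ} (hG : Differentiable ℝ G) (t : ℝ) (p : V n) :
    TT G (t, p) = fderiv ℝ G (t, p) (1, 0) + fderiv ℝ (fun p => G (t, p)) p (p.2, 0) := by
  rw [fderiv_slice hG, ← map_add]
  simp [TT, Y0]

/-- Vlasov equation in the phase-space form. -/
lemma vlasov_form (hn : 3 ≤ n) {μ cn : ℝ} {f : ℝ → E n → E n → ℝ} {φ : ℝ → E n → ℝ}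
    (hf : SmoothTXV n f) {t : ℝ}
    (hφ : ∀ x : E n, φ t x = ∫ y : E n, cn * ‖x - y‖ ^ ((2 : ℝ) - (n : ℝ)) * rho f t y)
    (hV : ∀ x v, Tphi μ φ f t x v = 0)
    (hc : HasCompactSupport (fun p : E n × E n => f t p.1 p.2)) (p : V n) :
    TT (fun u : U n => f u.1 u.2.1 u.2.2) (t, p)
      = -(μ * cn) * B (fun p => f t p.1 p.2) (fun p => f t p.1 p.2) p := by
  set G : U n → ℝ := fun u : U n => f u.1 u.2.1 u.2.2
  have hGs : ContDiff ℝ ∞ G := hf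
  have hGd : Differentiable ℝ G := hGs.differentiable (by simp)
  set g : V n → ℝ := fun p => f t p.1 p.2
  have hg : Sm g := ⟨hGs.comp (contDiff_const.prodMk contDiff_id), hc⟩
  have hφ' : φ t = fun x => cn * Phi g (x, p.2) := by
    ext x
    rw [hφ, Phi_eq hn hg, ← integral_const_mul]
    refine integral_congr_ae (Filter.Eventually.of_forall fun y => ?_)
    simp only [rho, g, mul_assoc]
  have hPd : Differentiable ℝ (Phi g) := (contDiff_Phi hn hg).differentiable (by simp)
  have hpd : ∀ i, pd i (φ t) p.1 = cn * fderiv ℝ (Phi g) p (EuclideanSpace.single i 1, 0) := by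
    intro i
    have := pd_fst (g := fun p => cn * Phi g p) (hPd.const_mul cn) i p.1 p.2
    rw [hφ', this, fderiv_const_mul (hPd _)]
    simp
  have h := hV p.1 p.2
  unfold Tphi Tfree at h
  rw [(deriv_slice hGd t p).deriv] at h
  have h1 : ∀ i, pd i (fun y => f t y p.2) p.1 = fderiv ℝ g p (EuclideanSpace.single i 1, 0) :=
    fun i => pd_fst hg.diff i p.1 p.2
  have h2 : ∀ i, pd i (fun w => f t p.1 w) p.2 = fderiv ℝ g p (0, EuclideanSpace.single i 1) :=
    fun i => pd_snd hg.diff i p.1 p.2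
  simp only [h1, h2, hpd] at h
  rw [← clm_fst] at h
  have h3 : TT G (t, p) = fderiv ℝ G (t, p) (1, 0) + fderiv ℝ g p (p.2, 0) := TT_eq hGd t p
  rw [h3]
  have h4 : ∑ i, cn * fderiv ℝ (Phi g) p (EuclideanSpace.single i 1, 0)
      * fderiv ℝ g p (0, EuclideanSpace.single i 1) = cn * B g g p := by
    unfold B; rw [Finset.mul_sum]
    exact Finset.sum_congr rfl fun i _ => by ring
  rw [h4] at h
  linarith

lemma vlasov_comm (hn : 3 ≤ n) {μ cn : ℝ} {f : ℝ → E n → E n → ℝ} {φ : ℝ → E n → ℝ}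
    (hf : SmoothTXV n f) {t : ℝ}
    (hφ : ∀ x : E n, φ t x = ∫ y : E n, cn * ‖x - y‖ ^ ((2 : ℝ) - (n : ℝ)) * rho f t y)
    (hV : ∀ x v, Tphi μ φ f t x v = 0)
    (hc : HasCompactSupport (fun p : E n × E n => f t p.1 p.2)) (L : List (VFIdx n)) (p : V n) :
    TT (DUL L (fun u : U n => f u.1 u.2.1 u.2.2)) (t, p)
      = -(μ * cn) * (B (fun p => f t p.1 p.2) (DL t L (fun p => f t p.1 p.2)) p
          + evalT t (fun p => f t p.1 p.2) (Terms L) p) := by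
  have hGs : ContDiff ℝ ∞ (fun u : U n => f u.1 u.2.1 u.2.2) := hf
  have hg : Sm (fun p : V n => f t p.1 p.2) := ⟨hGs.comp (contDiff_const.prodMk contDiff_id), hc⟩
  rw [TT_DUL hGs, DUL_slice (contDiff_TT hGs)]
  have : (fun p => TT (fun u : U n => f u.1 u.2.1 u.2.2) (t, p))
      = fun p => -(μ * cn) * B (fun p => f t p.1 p.2) (fun p => f t p.1 p.2) p := by
    ext p; exact vlasov_form hn hf hφ hV hc p
  rw [this, DL_const_mul (contDiff_B hn hg hg), DL_B hn hg]

end VP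

namespace VP
open scoped ContDiff

/-- smooth approximation of the absolute value -/
def be (δ s : ℝ) : ℝ := Real.sqrt (s ^ 2 + δ ^ 2) - δ

def be' (δ s : ℝ) : ℝ := s / Real.sqrt (s ^ 2 + δ ^ 2)

lemma hasDerivAt_be {δ : ℝ} (hδ : 0 < δ) (s : ℝ) : HasDerivAt (be δ) (be' δ s) s := by
  unfold be be'
  have h1 : HasDerivAt (fun s : ℝ => s ^ 2 + δ ^ 2) (2 * s) s := by
    simpa using (hasDerivAt_pow 2 s).add_const (δ ^ 2)
  have h2 := (h1.sqrt (by positivity)).sub_const δ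
  rw [mul_div_mul_left _ _ two_ne_zero] at h2
  exact h2

lemma contDiff_be {δ : ℝ} (hδ : 0 < δ) : ContDiff ℝ ∞ (be δ) := by
  unfold be
  refine ContDiff.sub (ContDiff.sqrt (by fun_prop) fun s => by positivity) contDiff_const

lemma continuous_be' {δ : ℝ} (hδ : 0 < δ) : Continuous (be' δ) := by
  unfold be'
  refine continuous_id.div (by fun_prop) fun s => by positivity

lemma abs_be'_le {δ : ℝ} (hδ : 0 < δ) (s : ℝ) : |be' δ s| ≤ 1 := by
  unfold be'
  have h0 : 0 < Real.sqrt (s ^ 2 + δ ^ 2) := by positivity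
  rw [abs_div, abs_of_pos h0, div_le_one h0]
  exact Real.abs_le_sqrt (by nlinarith)

lemma be_zero {δ : ℝ} (hδ : 0 < δ) : be δ 0 = 0 := by
  simp [be, Real.sqrt_sq hδ.le]

lemma be_nonneg {δ : ℝ} (hδ : 0 < δ) (s : ℝ) : 0 ≤ be δ s := by
  unfold be
  have : δ ≤ Real.sqrt (s ^ 2 + δ ^ 2) := Real.le_sqrt_of_sq_le (by nlinarith)
  linarith

lemma be_le {δ : ℝ} (hδ : 0 < δ) (s : ℝ) : be δ s ≤ |s| := by
  unfold be
  have : Real.sqrt (s ^ 2 + δ ^ 2) ≤ |s| + δ := by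
    rw [Real.sqrt_le_left (by positivity)]
    nlinarith [abs_nonneg s, sq_abs s]
  linarith

lemma le_be (δ s : ℝ) : |s| - δ ≤ be δ s := by
  unfold be
  have : |s| ≤ Real.sqrt (s ^ 2 + δ ^ 2) := Real.abs_le_sqrt (by nlinarith)
  linarith

/-- The cutoff. -/
def bump (n : ℕ) : ContDiffBump (0 : V n) := ⟨1, 2, one_pos, one_lt_two⟩

def ch (R : ℝ) (p : V n) : ℝ := bump n (R⁻¹ • p)

lemma contDiff_ch (R : ℝ) : ContDiff ℝ ∞ (ch R : V n → ℝ) := by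
  unfold ch
  exact (bump n).contDiff.comp (contDiff_const_smul _)

lemma ch_nonneg (R : ℝ) (p : V n) : 0 ≤ ch R p := (bump n).nonneg

lemma ch_le_one (R : ℝ) (p : V n) : ch R p ≤ 1 := (bump n).le_one

lemma ch_eq_one {R : ℝ} (hR : 0 < R) {p : V n} (hp : ‖p‖ ≤ R) : ch R p = 1 := by
  apply (bump n).one_of_mem_closedBall
  rw [mem_closedBall_zero_iff, norm_smul, norm_inv, Real.norm_eq_abs, abs_of_pos hR]
  rw [inv_mul_le_iff₀ hR]
  simpa [bump] using hp

lemma ch_eq_zero {R : ℝ} (hR : 0 < R) {p : V n} (hp : 2 * R ≤ ‖p‖) : ch R p = 0 := by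
  apply (bump n).zero_of_le_dist
  rw [dist_zero_right, norm_smul, norm_inv, Real.norm_eq_abs, abs_of_pos hR]
  rw [le_inv_mul_iff₀ hR]
  simpa [bump, mul_comm] using hp

lemma hcs_ch {R : ℝ} (hR : 0 < R) : HasCompactSupport (ch R : V n → ℝ) := by
  refine HasCompactSupport.intro (isCompact_closedBall (0 : V n) (2 * R)) fun p hp => ?_
  rw [mem_closedBall_zero_iff, not_le] at hp
  exact ch_eq_zero hR hp.le

lemma exists_C0 (n : ℕ) : ∃ C0 : ℝ, 0 ≤ C0 ∧ ∀ (R : ℝ), 0 < R → ∀ p e : V n,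
    |fderiv ℝ (ch R) p e| ≤ C0 * R⁻¹ * ‖e‖ := by
  have h1 : Continuous (fderiv ℝ (bump n : V n → ℝ)) :=
    ((bump n).contDiff (n := 1)).continuous_fderiv (by simp)
  obtain ⟨C, hC⟩ := h1.bounded_above_of_compact_support ((bump n).hasCompactSupport.fderiv ℝ)
  refine ⟨C, (norm_nonneg _).trans (hC 0), fun R hR p e => ?_⟩
  unfold ch
  rw [fderiv_comp_smul (f := bump n)]
  rw [smul_apply, smul_eq_mul, abs_mul, abs_of_pos (inv_pos.2 hR)]
  have : |fderiv ℝ (bump n) (R⁻¹ • p) e| ≤ C * ‖e‖ :=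
    ((fderiv ℝ (bump n) (R⁻¹ • p)).le_opNorm e).trans (by gcongr; exact hC _)
  have hR' : 0 < R⁻¹ := inv_pos.2 hR
  nlinarith

lemma fderiv_ch_small {R : ℝ} (hR : 0 < R) {p : V n} (hp : ‖p‖ < R) (e : V n) :
    fderiv ℝ (ch R) p e = 0 := by
  have : (ch R : V n → ℝ) =ᶠ[nhds p] fun _ => 1 := by
    filter_upwards [Metric.isOpen_ball.mem_nhds (show p ∈ Metric.ball 0 R by simpa using hp)] with q hq
    exact ch_eq_one hR (by simpa using le_of_lt (by simpa using hq : ‖q‖ < R))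
  rw [this.fderiv_eq]; simp

lemma fderiv_ch_large {R : ℝ} (hR : 0 < R) {p : V n} (hp : 2 * R < ‖p‖) (e : V n) :
    fderiv ℝ (ch R) p e = 0 := by
  have : (ch R : V n → ℝ) =ᶠ[nhds p] fun _ => 0 := by
    filter_upwards [(isOpen_lt continuous_const continuous_norm).mem_nhds (show p ∈ {p : V n | 2 * R < ‖p‖} from hp)] with q hq
    exact ch_eq_zero hR (le_of_lt hq)
  rw [this.fderiv_eq]; simp

lemma ibp {χ a w : V n → ℝ} (hχ : ContDiff ℝ ∞ χ) (ha : ContDiff ℝ ∞ a) (hw : Sm w) (e : V n)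
    (hae : ∀ p, fderiv ℝ a p e = 0) :
    ∫ p, χ p * (a p * fderiv ℝ w p e) = - ∫ p, (a p * fderiv ℝ χ p e) * w p := by
  have hχd : Differentiable ℝ χ := hχ.differentiable (by simp)
  have had : Differentiable ℝ a := ha.differentiable (by simp)
  have hf : ∀ p, fderiv ℝ (fun p => χ p * a p) p e = a p * fderiv ℝ χ p e := by
    intro p
    rw [fderiv_fun_mul (hχd p) (had p)]
    simp [hae]
  have h := integral_mul_fderiv_eq_neg_fderiv_mul_of_integrable (μ := (volume : Measure (V n)))
    (f := fun p => χ p * a p) (g := w) (v := e) ?_ ?_ ?_ ?_ ?_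
  · simp only [hf] at h
    rw [← h]
    congr 1; ext p; ring
  · simp only [hf]
    refine Continuous.integrable_of_hasCompactSupport ?_ (HasCompactSupport.mul_left hw.cpt)
    exact (ha.continuous.mul (contDiff_dir hχ e).continuous).mul hw.continuous
  · refine Continuous.integrable_of_hasCompactSupport ?_ (HasCompactSupport.mul_left (hw.dir e).cpt)
    exact (hχ.continuous.mul ha.continuous).mul (hw.dir e).continuous
  · refine Continuous.integrable_of_hasCompactSupport ?_ (HasCompactSupport.mul_left hw.cpt)
    exact (hχ.continuous.mul ha.continuous).mul hw.continuous
  · exact fun x _ => (hχd x).mul (had x)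
  · exact fun x _ => hw.diff x

lemma ibp_sum {ι : Type*} [Fintype ι] {χ w : V n → ℝ} {a : ι → V n → ℝ} (hχ : ContDiff ℝ ∞ χ)
    (ha : ∀ j, ContDiff ℝ ∞ (a j)) (hw : Sm w) (e : ι → V n)
    (hae : ∀ j p, fderiv ℝ (a j) p (e j) = 0) :
    ∫ p, χ p * ∑ j, a j p * fderiv ℝ w p (e j)
      = - ∫ p, fderiv ℝ χ p (∑ j, a j p • e j) * w p := by
  simp only [map_sum, map_smul, smul_eq_mul, Finset.mul_sum, Finset.sum_mul]
  rw [integral_finset_sum, integral_finset_sum, ← Finset.sum_neg_distrib]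
  · exact Finset.sum_congr rfl fun j _ => ibp hχ (ha j) hw (e j) (hae j)
  · intro j _
    refine Continuous.integrable_of_hasCompactSupport ?_ (HasCompactSupport.mul_left hw.cpt)
    exact ((ha j).continuous.mul (contDiff_dir hχ _).continuous).mul hw.continuous
  · intro j _
    refine Continuous.integrable_of_hasCompactSupport ?_
      (HasCompactSupport.mul_left (HasCompactSupport.mul_left (hw.dir (e j)).cpt))
    exact hχ.continuous.mul ((ha j).continuous.mul (hw.dir _).continuous)

/-- differentiation under the integral with a spatial cutoff -/
lemma param_deriv {H h : U n → ℝ} (hH : Continuous H) (hh : Continuous h) (K : Set (V n)) (hK : IsCompact K)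
    (hHK : ∀ t p, p ∉ K → H (t, p) = 0) (hhK : ∀ t p, p ∉ K → h (t, p) = 0)
    (hd : ∀ t p, HasDerivAt (fun s => H (s, p)) (h (t, p)) t) (t : ℝ) :
    HasDerivAt (fun t => ∫ p, H (t, p)) (∫ p, h (t, p)) t := by
  obtain ⟨C, hC⟩ := ((isCompact_Icc (a := t - 1) (b := t + 1)).prod hK).exists_bound_of_continuousOn
    hh.continuousOn
  have hsl : ∀ s, Continuous (fun p : V n => H (s, p)) := fun s => by fun_prop
  have hsl' : ∀ s, Continuous (fun p : V n => h (s, p)) := fun s => by fun_prop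
  refine (hasDerivAt_integral_of_dominated_loc_of_deriv_le (𝕜 := ℝ) (F := fun s p => H (s, p))
    (F' := fun s p => h (s, p)) (bound := K.indicator fun _ => C)
    (Icc_mem_nhds (by linarith : t - 1 < t) (by linarith : t < t + 1)) ?_ ?_ ?_ ?_ ?_ ?_).2
  · exact Filter.Eventually.of_forall fun s => (hsl s).aestronglyMeasurable
  · exact (hsl t).integrable_of_hasCompactSupport (HasCompactSupport.intro hK fun p hp => hHK t p hp)
  · exact (hsl' t).aestronglyMeasurable
  · refine Filter.Eventually.of_forall fun p s hs => ?_
    by_cases hp : p ∈ K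
    · rw [Set.indicator_of_mem hp]; exact hC (s, p) ⟨hs, hp⟩
    · rw [Set.indicator_of_notMem hp, hhK s p hp]; simp
  · rw [integrable_indicator_iff hK.measurableSet]
    exact integrableOn_const hK.measure_lt_top.ne
  · exact Filter.Eventually.of_forall fun p s _ => hd s p

end VP

namespace VP
open scoped ContDiff

def Hf (G : U n → ℝ) (R t : ℝ) : ℝ :=
  ∫ p, Set.indicator {p : V n | R ≤ ‖p‖} (fun p => |G (t, p)|) p

lemma meas_far (R : ℝ) : MeasurableSet {p : V n | R ≤ ‖p‖} :=
  (isClosed_le continuous_const continuous_norm).measurableSet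

lemma Hf_nonneg (G : U n → ℝ) (R t : ℝ) : 0 ≤ Hf G R t :=
  integral_nonneg fun p => Set.indicator_nonneg (fun _ _ => abs_nonneg _) p

lemma Hf_le (G : U n → ℝ) (R t : ℝ) (hG : Sm (fun p => G (t, p))) :
    Hf G R t ≤ ∫ p, |G (t, p)| := by
  refine integral_mono (hG.integrable.abs.indicator (meas_far R)) hG.integrable.abs fun p => ?_
  exact Set.indicator_le_self' (fun _ _ => abs_nonneg _) p

lemma Hf_meas (G : U n → ℝ) (hG : Continuous G) (R : ℝ) : StronglyMeasurable (Hf G R) := by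
  unfold Hf
  have : StronglyMeasurable (fun u : U n => Set.indicator {u : U n | R ≤ ‖u.2‖} (fun u => |G u|) u) :=
    hG.abs.stronglyMeasurable.indicator
      (isClosed_le continuous_const continuous_snd.norm).measurableSet
  exact this.integral_prod_right (ν := (volume : Measure (V n)))

lemma I_bound {ι : Type*} [Fintype ι] {g S w : V n → ℝ} {a : ι → V n → ℝ} {e : ι → V n}
    {M C0 R δ : ℝ} (hM : 0 ≤ M) (hR : 1 ≤ R) (hδ : 0 < δ)
    (hC0 : 0 ≤ C0) (hC : ∀ p e : V n, |fderiv ℝ (ch R) p e| ≤ C0 * R⁻¹ * ‖e‖)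
    (hg : Sm g) (ha : ∀ j, ContDiff ℝ ∞ (a j))
    (hae : ∀ j p, fderiv ℝ (a j) p (e j) = 0) (haM : ∀ p, ‖∑ j, a j p • e j‖ ≤ ‖p‖ + M)
    (hS : Sm S) (hw : ∀ p, w p = - ∑ j, a j p * fderiv ℝ g p (e j) - S p) :
    ∫ p, ch R p * (be' δ (g p) * w p) ≤ (∫ p, |S p|) +
      C0 * (2 + M) * ∫ p, Set.indicator {p : V n | R ≤ ‖p‖} (fun p => |g p|) p := by
  have hR0 : 0 < R := by linarith
  have hws : Sm (fun p => be δ (g p)) :=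
    ⟨(contDiff_be hδ).comp hg.smooth, hg.cpt.comp_left (be_zero hδ)⟩
  have hfd : ∀ p e, fderiv ℝ (fun p => be δ (g p)) p e = be' δ (g p) * fderiv ℝ g p e := by
    intro p e
    have := (hasDerivAt_be hδ (g p)).comp_hasFDerivAt p (hg.diff p).hasFDerivAt
    have h2 : fderiv ℝ (fun p => be δ (g p)) p = be' δ (g p) • fderiv ℝ g p := this.fderiv
    rw [h2]; simp
  have hch := contDiff_ch (n := n) R
  have hi2 : Integrable (fun p => ch R p * (be' δ (g p) * S p)) := by
    refine Continuous.integrable_of_hasCompactSupport ?_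
      (HasCompactSupport.mul_left (HasCompactSupport.mul_left hS.cpt))
    exact hch.continuous.mul (((continuous_be' hδ).comp hg.continuous).mul hS.continuous)
  have hi1 : Integrable (fun p => ch R p * ∑ j, a j p * fderiv ℝ (fun p => be δ (g p)) p (e j)) := by
    refine Continuous.integrable_of_hasCompactSupport ?_ (HasCompactSupport.mul_right (hcs_ch hR0))
    refine hch.continuous.mul (continuous_finset_sum _ fun j _ => ?_)
    exact (ha j).continuous.mul (hws.dir (e j)).continuous
  have hi3 : Integrable (fun p => fderiv ℝ (ch R) p (∑ j, a j p • e j) * be δ (g p)) := by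
    refine Continuous.integrable_of_hasCompactSupport ?_ (HasCompactSupport.mul_left hws.cpt)
    refine Continuous.mul ?_ hws.continuous
    refine (hch.continuous_fderiv (by simp)).clm_apply (continuous_finset_sum _ fun j _ => ?_)
    exact (ha j).continuous.smul continuous_const
  have e1 : ∫ p, ch R p * (be' δ (g p) * w p) =
      (∫ p, fderiv ℝ (ch R) p (∑ j, a j p • e j) * be δ (g p))
        - ∫ p, ch R p * (be' δ (g p) * S p) := by
    have h := ibp_sum hch ha hws e hae
    rw [eq_neg_iff_add_eq_zero, add_comm] at h
    rw [eq_neg_of_add_eq_zero_left h, ← integral_neg]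
    refine Eq.trans ?_ (integral_sub hi1.neg hi2)
    refine integral_congr_ae (Filter.Eventually.of_forall fun p => ?_)
    simp only [Pi.neg_apply, hfd, hw]
    have : ∑ j, a j p * (be' δ (g p) * fderiv ℝ g p (e j))
        = be' δ (g p) * ∑ j, a j p * fderiv ℝ g p (e j) := by
      rw [Finset.mul_sum]; exact Finset.sum_congr rfl fun j _ => by ring
    rw [this]; ring
  rw [e1, ← integral_const_mul, sub_eq_add_neg, add_comm, ← integral_neg]
  refine add_le_add (integral_mono hi2.neg hS.integrable.abs fun p => ?_)
    (integral_mono hi3 ((hg.integrable.abs.indicator (meas_far R)).const_mul _) fun p => ?_)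
  · simp only
    refine (neg_le_abs _).trans ?_
    rw [abs_mul, abs_mul, abs_of_nonneg (ch_nonneg R p)]
    have h1 := abs_be'_le hδ (g p)
    have h2 := ch_le_one R p
    have h3 := abs_nonneg (S p)
    have h4 : |be' δ (g p)| * |S p| ≤ |S p| := by nlinarith
    have h5 := mul_le_mul h2 h4 (by positivity) zero_le_one
    linarith
  · simp only
    have hb0 := be_nonneg hδ (g p)
    have hb1 := be_le hδ (g p)
    rcases lt_or_ge ‖p‖ R with hp | hp
    · rw [fderiv_ch_small hR0 hp, zero_mul]
      have : 0 ≤ Set.indicator {p : V n | R ≤ ‖p‖} (fun p => |g p|) p :=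
        Set.indicator_nonneg (fun _ _ => abs_nonneg _) p
      positivity
    · rw [Set.indicator_of_mem (show p ∈ {p : V n | R ≤ ‖p‖} from hp)]
      rcases lt_or_ge (2 * R) ‖p‖ with hp2 | hp2
      · rw [fderiv_ch_large hR0 hp2, zero_mul]
        positivity
      · have h1 : fderiv ℝ (ch R) p (∑ j, a j p • e j) ≤ C0 * (2 + M) := by
          refine (le_abs_self _).trans ((hC p _).trans ?_)
          rw [mul_assoc]
          gcongr
          rw [inv_mul_le_iff₀ hR0]
          refine (haM p).trans ?_
          nlinarith
        calc _ ≤ C0 * (2 + M) * be δ (g p) := by gcongr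
          _ ≤ _ := by gcongr

lemma I_step {ι : Type*} [Fintype ι] {G : U n → ℝ} (hG : ContDiff ℝ ∞ G) {t1 : ℝ} (ht1 : 0 ≤ t1)
    {a : ℝ → ι → V n → ℝ} {e : ι → V n} {M A : ℝ} (hM : 0 ≤ M) {b : ℝ → ℝ} (hb : Continuous b)
    {S : ℝ → V n → ℝ}
    (hGs : ∀ t ∈ Set.Icc 0 t1, Sm (fun p => G (t, p)))
    (ha : ∀ t ∈ Set.Icc 0 t1, ∀ j, ContDiff ℝ ∞ (a t j))
    (hae : ∀ t ∈ Set.Icc 0 t1, ∀ j p, fderiv ℝ (a t j) p (e j) = 0)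
    (haM : ∀ t ∈ Set.Icc 0 t1, ∀ p, ‖∑ j, a t j p • e j‖ ≤ ‖p‖ + M)
    (hS : ∀ t ∈ Set.Icc 0 t1, Sm (S t))
    (hSb : ∀ t ∈ Set.Icc 0 t1, ∫ p, |S t p| ≤ b t)
    (hA : ∀ t ∈ Set.Icc 0 t1, ∫ p, |G (t, p)| ≤ A)
    (heq : ∀ t ∈ Set.Icc 0 t1, ∀ p, fderiv ℝ G (t, p) (1, 0)
      = - ∑ j, a t j p * fderiv ℝ (fun p => G (t, p)) p (e j) - S t p)
    {C0 R δ : ℝ} (hR : 1 ≤ R) (hδ : 0 < δ) (hC0 : 0 ≤ C0)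
    (hC : ∀ p e : V n, |fderiv ℝ (ch R) p e| ≤ C0 * R⁻¹ * ‖e‖) :
    ∫ p, ch R p * be δ (G (t1, p)) ≤ (∫ p, |G (0, p)|) + (∫ s in (0:ℝ)..t1, b s)
      + C0 * (2 + M) * ∫ s in (0:ℝ)..t1, Hf G R s := by
  have hR0 : 0 < R := by linarith
  have hch := contDiff_ch (n := n) R
  have hder : ∀ t, HasDerivAt (fun t => ∫ p, ch R p * be δ (G (t, p)))
      (∫ p, ch R p * (be' δ (G (t, p)) * fderiv ℝ G (t, p) (1, 0))) t := by
    intro t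
    refine param_deriv (H := fun u => ch R u.2 * be δ (G u))
      (h := fun u => ch R u.2 * (be' δ (G u) * fderiv ℝ G u (1, 0))) ?_ ?_
      (Metric.closedBall 0 (2 * R)) (isCompact_closedBall _ _) ?_ ?_ ?_ t
    · exact (hch.continuous.comp continuous_snd).mul ((contDiff_be hδ).continuous.comp hG.continuous)
    · exact (hch.continuous.comp continuous_snd).mul
        (((continuous_be' hδ).comp hG.continuous).mul
          ((hG.continuous_fderiv (by simp)).clm_apply continuous_const))
    · intro t p hp
      rw [mem_closedBall_zero_iff, not_le] at hp
      simp [ch_eq_zero hR0 hp.le]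
    · intro t p hp
      rw [mem_closedBall_zero_iff, not_le] at hp
      simp [ch_eq_zero hR0 hp.le]
    · intro t p
      exact ((hasDerivAt_be hδ (G (t, p))).comp t
        (deriv_slice (hG.differentiable (by simp)) t p)).const_mul (ch R p)
  have hHi : IntegrableOn (Hf G R) (Set.Icc 0 t1) := by
    refine Measure.integrableOn_of_bounded (M := A) (by simp)
      (Hf_meas G hG.continuous R).aestronglyMeasurable ?_
    filter_upwards [ae_restrict_mem measurableSet_Icc] with t ht
    rw [Real.norm_eq_abs, abs_of_nonneg (Hf_nonneg _ _ _)]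
    exact (Hf_le G R t (hGs t ht)).trans (hA t ht)
  have hbi : IntegrableOn b (Set.Icc 0 t1) := hb.continuousOn.integrableOn_Icc
  have h := intervalIntegral.sub_le_integral_of_hasDeriv_right_of_le ht1
    (g := fun t => ∫ p, ch R p * be δ (G (t, p)))
    (φ := fun t => b t + C0 * (2 + M) * Hf G R t)
    (fun t _ => (hder t).continuousAt.continuousWithinAt)
    (fun t _ => (hder t).hasDerivWithinAt) (hbi.add (hHi.const_mul _)) ?_
  · rw [intervalIntegral.integral_add, intervalIntegral.integral_const_mul] at h
    · have h0 : (0:ℝ) ∈ Set.Icc 0 t1 := ⟨le_rfl, ht1⟩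
      have h2 : ∫ p, ch R p * be δ (G (0, p)) ≤ ∫ p, |G (0, p)| := by
        refine integral_mono ?_ (hGs 0 h0).integrable.abs fun p => ?_
        · refine Continuous.integrable_of_hasCompactSupport ?_ (HasCompactSupport.mul_right (hcs_ch hR0))
          exact hch.continuous.mul ((contDiff_be hδ).continuous.comp (hGs 0 h0).continuous)
        · have h1 := ch_le_one R p
          have h2 := be_le hδ (G (0, p))
          have h3 := be_nonneg hδ (G (0, p))
          simp only
          nlinarith [ch_nonneg R p]
      linarith
    · exact hb.intervalIntegrable _ _
    · exact ((intervalIntegrable_iff_integrableOn_Icc_of_le ht1).2 hHi).const_mul _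
  · intro t ht
    have ht' : t ∈ Set.Icc 0 t1 := ⟨ht.1.le, ht.2.le⟩
    have := I_bound (g := fun p => G (t, p)) (S := S t) (w := fun p => fderiv ℝ G (t, p) (1, 0))
      (e := e) hM hR hδ hC0 hC (hGs t ht') (ha t ht') (hae t ht') (haM t ht') (hS t ht') (heq t ht')
    have h2 := hSb t ht'
    simp only [Hf]
    linarith

lemma L1est {ι : Type*} [Fintype ι] {G : U n → ℝ} (hG : ContDiff ℝ ∞ G) {t1 : ℝ} (ht1 : 0 ≤ t1)
    {a : ℝ → ι → V n → ℝ} {e : ι → V n} {M A : ℝ} (hM : 0 ≤ M) {b : ℝ → ℝ} (hb : Continuous b)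
    {S : ℝ → V n → ℝ}
    (hGs : ∀ t ∈ Set.Icc 0 t1, Sm (fun p => G (t, p)))
    (ha : ∀ t ∈ Set.Icc 0 t1, ∀ j, ContDiff ℝ ∞ (a t j))
    (hae : ∀ t ∈ Set.Icc 0 t1, ∀ j p, fderiv ℝ (a t j) p (e j) = 0)
    (haM : ∀ t ∈ Set.Icc 0 t1, ∀ p, ‖∑ j, a t j p • e j‖ ≤ ‖p‖ + M)
    (hS : ∀ t ∈ Set.Icc 0 t1, Sm (S t))
    (hSb : ∀ t ∈ Set.Icc 0 t1, ∫ p, |S t p| ≤ b t)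
    (hA : ∀ t ∈ Set.Icc 0 t1, ∫ p, |G (t, p)| ≤ A)
    (heq : ∀ t ∈ Set.Icc 0 t1, ∀ p, fderiv ℝ G (t, p) (1, 0)
      = - ∑ j, a t j p * fderiv ℝ (fun p => G (t, p)) p (e j) - S t p) :
    ∫ p, |G (t1, p)| ≤ (∫ p, |G (0, p)|) + ∫ s in (0:ℝ)..t1, b s := by
  obtain ⟨C0, hC0, hC⟩ := exists_C0 n
  have hk1 : ∀ k : ℕ, (1:ℝ) ≤ (k:ℝ) + 1 := fun k => by linarith [Nat.cast_nonneg (α := ℝ) k]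
  have hk0 : ∀ k : ℕ, (0:ℝ) < (k:ℝ) + 1 := fun k => by linarith [hk1 k]
  have key : ∀ k : ℕ, _ := fun k =>
    I_step hG ht1 hM hb hGs ha hae haM hS hSb hA heq (R := (k:ℝ) + 1) (δ := 1 / ((k:ℝ) + 1))
      (hk1 k) (by have := hk0 k; positivity) hC0 (hC _ (hk0 k))
  have h1m : t1 ∈ Set.Icc 0 t1 := ⟨ht1, le_rfl⟩
  have hRlim : Filter.Tendsto (fun k : ℕ => (k:ℝ) + 1) Filter.atTop Filter.atTop :=
    Filter.tendsto_atTop_add_const_right _ _ tendsto_natCast_atTop_atTop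
  have lim1 : Filter.Tendsto (fun k : ℕ => ∫ p, ch ((k:ℝ) + 1) p * be (1 / ((k:ℝ) + 1)) (G (t1, p)))
      Filter.atTop (nhds (∫ p, |G (t1, p)|)) := by
    refine tendsto_integral_of_dominated_convergence (fun p => |G (t1, p)|) ?_
      (hGs t1 h1m).integrable.abs ?_ ?_
    · intro k
      exact ((contDiff_ch _).continuous.mul ((contDiff_be (by have := hk0 k; positivity)).continuous.comp
        (hGs t1 h1m).continuous)).aestronglyMeasurable
    · intro k
      refine Filter.Eventually.of_forall fun p => ?_
      have hd : (0:ℝ) < 1 / ((k:ℝ) + 1) := by have := hk0 k; positivity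
      have h1 := ch_le_one ((k:ℝ) + 1) p
      have h2 := be_le hd (G (t1, p))
      have h3 := be_nonneg hd (G (t1, p))
      have h4 := ch_nonneg ((k:ℝ) + 1) p
      rw [Real.norm_eq_abs, abs_of_nonneg (mul_nonneg h4 h3)]
      nlinarith
    · refine Filter.Eventually.of_forall fun p => ?_
      have hbe : Filter.Tendsto (fun k : ℕ => be (1 / ((k:ℝ) + 1)) (G (t1, p))) Filter.atTop
          (nhds |G (t1, p)|) := by
        have h0 : Filter.Tendsto (fun k : ℕ => |G (t1, p)| - 1 / ((k:ℝ) + 1)) Filter.atTop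
          (nhds |G (t1, p)|) := by
          simpa using tendsto_const_nhds.sub (tendsto_one_div_add_atTop_nhds_zero_nat (𝕜 := ℝ))
        refine tendsto_of_tendsto_of_tendsto_of_le_of_le h0 tendsto_const_nhds (fun k => le_be _ _)
          (fun k => be_le (by have := hk0 k; positivity) _)
      refine hbe.congr' ?_
      filter_upwards [hRlim.eventually_ge_atTop ‖p‖] with k hk
      rw [ch_eq_one (hk0 k) hk, one_mul]
  have lim2 : Filter.Tendsto (fun k : ℕ => ∫ s in (0:ℝ)..t1, Hf G ((k:ℝ) + 1) s)
      Filter.atTop (nhds (∫ s in (0:ℝ)..t1, (0:ℝ))) := by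
    refine intervalIntegral.tendsto_integral_filter_of_dominated_convergence (fun _ => A) ?_ ?_
      (by simp) ?_
    · exact Filter.Eventually.of_forall fun k => (Hf_meas G hG.continuous _).aestronglyMeasurable
    · refine Filter.Eventually.of_forall fun k => Filter.Eventually.of_forall fun t ht => ?_
      rw [Set.uIoc_of_le ht1] at ht
      have ht' : t ∈ Set.Icc 0 t1 := ⟨ht.1.le, ht.2⟩
      rw [Real.norm_eq_abs, abs_of_nonneg (Hf_nonneg _ _ _)]
      exact (Hf_le G _ t (hGs t ht')).trans (hA t ht')
    · refine Filter.Eventually.of_forall fun t ht => ?_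
      rw [Set.uIoc_of_le ht1] at ht
      have ht' : t ∈ Set.Icc 0 t1 := ⟨ht.1.le, ht.2⟩
      obtain ⟨r, hr⟩ := (hGs t ht').cpt.isCompact.isBounded.subset_closedBall 0
      refine tendsto_const_nhds.congr' ?_
      filter_upwards [hRlim.eventually_gt_atTop r] with k hk
      symm
      unfold Hf
      refine integral_eq_zero_of_ae (Filter.Eventually.of_forall fun p => ?_)
      simp only [Set.indicator, Pi.zero_apply]
      split_ifs with hp
      · have : G (t, p) = 0 := by
          by_contra hne
          have := hr (subset_tsupport (fun p => G (t, p)) hne)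
          rw [mem_closedBall_zero_iff] at this
          have hp' : (k:ℝ) + 1 ≤ ‖p‖ := hp
          linarith
        simp [this]
      · rfl
  have lim3 := (lim2.const_mul (C0 * (2 + M))).const_add ((∫ p, |G (0, p)|) + (∫ s in (0:ℝ)..t1, b s))
  have := le_of_tendsto_of_tendsto' lim1 lim3 key
  simpa using this

end VP

namespace VP
open scoped ContDiff

def eJ : Fin n ⊕ Fin n → V n
  | Sum.inl i => (EuclideanSpace.single i 1, 0)
  | Sum.inr i => (0, EuclideanSpace.single i 1)

def aJ (c : ℝ) (g : V n → ℝ) : Fin n ⊕ Fin n → V n → ℝ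
  | Sum.inl i => fun p => p.2 i
  | Sum.inr i => fun p => c * fderiv ℝ (Phi g) p (EuclideanSpace.single i 1, 0)

lemma contDiff_aJ (hn : 3 ≤ n) (c : ℝ) {g : V n → ℝ} (hg : Sm g) (j) : ContDiff ℝ ∞ (aJ c g j) := by
  rcases j with i | i
  · simp only [aJ]; fun_prop
  · exact contDiff_const.mul (contDiff_dir (contDiff_Phi hn hg) _)

lemma fderiv_const_dir {F : V n → ℝ} (hF : Differentiable ℝ F) (e : V n)
    (h : ∀ p (s : ℝ), F (p + s • e) = F p) (p : V n) : fderiv ℝ F p e = 0 := by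
  have h1 : HasDerivAt (fun s : ℝ => p + s • e) e 0 := by
    simpa using ((hasDerivAt_id (0:ℝ)).smul_const e).const_add p
  have h2 : HasFDerivAt F (fderiv ℝ F p) (p + (0:ℝ) • e) := by simpa using (hF p).hasFDerivAt
  have h3 := h2.comp_hasDerivAt (0:ℝ) h1
  have h4 : (F ∘ fun s : ℝ => p + s • e) = fun _ => F p := by ext s; exact h p s
  rw [h4] at h3
  exact h3.unique (hasDerivAt_const _ _)

lemma div_aJ (hn : 3 ≤ n) (c : ℝ) {g : V n → ℝ} (hg : Sm g) (j) (p) :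
    fderiv ℝ (aJ c g j) p (eJ j) = 0 := by
  refine fderiv_const_dir ((contDiff_aJ hn c hg j).differentiable (by simp)) _ (fun p s => ?_) p
  rcases j with i | i
  · simp [aJ, eJ]
  · simp only [aJ, eJ]
    congr 1
    have : (fun q => Phi g (q + s • ((0 : E n), (EuclideanSpace.single i 1 : E n)))) = Phi g := by
      ext q
      have := Phi_indep hn hg q.1 (q.2 + s • (EuclideanSpace.single i 1 : E n)) q.2
      have h2 : q + s • ((0 : E n), (EuclideanSpace.single i 1 : E n))
          = (q.1, q.2 + s • (EuclideanSpace.single i 1 : E n)) := by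
        ext : 1 <;> simp
      rw [h2]; exact this
    conv_rhs => rw [← this]
    rw [fderiv_comp_add_right]

lemma aJ_norm (hn : 3 ≤ n) (c : ℝ) {g : V n → ℝ} {K : ℝ}
    (hK : ∀ p i, |fderiv ℝ (Phi g) p (EuclideanSpace.single i 1, 0)| ≤ K) (p : V n) :
    ‖∑ j, aJ c g j p • (eJ j : V n)‖ ≤ ‖p‖ + n * (|c| * K) := by
  rw [Fintype.sum_sum_type]
  refine (norm_add_le _ _).trans (add_le_add ?_ ?_)
  · have : ∑ i : Fin n, aJ c g (Sum.inl i) p • (eJ (Sum.inl i) : V n) = (p.2, 0) := by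
      simp only [aJ, eJ, Prod.smul_mk, smul_zero]
      ext : 1
      · simp only [Prod.fst_sum]; exact (sum_coord p.2).symm
      · simp [Prod.snd_sum]
    rw [this, Prod.norm_mk]
    simpa using norm_snd_le p
  · refine (norm_sum_le _ _).trans ?_
    have : ∀ i ∈ (Finset.univ : Finset (Fin n)), ‖aJ c g (Sum.inr i) p • (eJ (Sum.inr i) : V n)‖ ≤ |c| * K := by
      intro i _
      rw [norm_smul]
      have h1 : ‖(eJ (Sum.inr i) : V n)‖ = 1 := by simp [eJ, Prod.norm_mk]
      rw [h1, mul_one]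
      simp only [aJ, Real.norm_eq_abs, abs_mul]
      gcongr
      exact hK p i
    refine (Finset.sum_le_sum this).trans ?_
    simp

lemma int_bound {t1 : ℝ} (ht : 0 ≤ t1) (K : ℝ) (hK : 0 ≤ K) :
    ∫ s in (0:ℝ)..t1, K * ((1 + |s|) ^ 2)⁻¹ ≤ K := by
  have h : ∫ s in (0:ℝ)..t1, K * ((1 + |s|) ^ 2)⁻¹ = K * (-(1 + t1)⁻¹) - K * (-(1 + 0)⁻¹) := by
    refine intervalIntegral.integral_eq_sub_of_hasDerivAt (f := fun s => K * (-(1 + s)⁻¹)) ?_ ?_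
    · intro s hs
      rw [Set.uIcc_of_le ht] at hs
      have h1 : HasDerivAt (fun s : ℝ => 1 + s) 1 s := (hasDerivAt_id s).const_add 1
      have h2 := ((h1.inv (by linarith [hs.1])).neg).const_mul K
      have h3 : K * -(-1 / (1 + s) ^ 2) = K * ((1 + |s|) ^ 2)⁻¹ := by
        rw [abs_of_nonneg hs.1]
        ring
      rw [h3] at h2
      exact h2
    · refine Continuous.intervalIntegrable ?_ _ _
      exact continuous_const.mul (Continuous.inv₀ (by fun_prop) fun s => by positivity)
  rw [h]
  have : 0 ≤ (1 + t1)⁻¹ := by positivity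
  norm_num
  nlinarith

lemma est_L (hn : 4 ≤ n) {N : ℕ} (hN : 2 * n ≤ N) {μ cn : ℝ} {f : ℝ → E n → E n → ℝ} {φ : ℝ → E n → ℝ}
    (hf : SmoothTXV n f) {t1 A : ℝ} (ht1 : 0 ≤ t1)
    (hφ : ∀ t ∈ Set.Icc 0 t1, ∀ x : E n, φ t x = ∫ y : E n, cn * ‖x - y‖ ^ ((2 : ℝ) - (n : ℝ)) * rho f t y)
    (hV : ∀ t ∈ Set.Icc 0 t1, ∀ x v, Tphi μ φ f t x v = 0)
    (hc : ∀ t ∈ Set.Icc 0 t1, HasCompactSupport (fun p : E n × E n => f t p.1 p.2))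
    (hE : ∀ t ∈ Set.Icc 0 t1, En N t (fun p : V n => f t p.1 p.2) ≤ A)
    (L : List (VFIdx n)) (hL : L.length ≤ N) {C : ℝ} (hC0 : 0 ≤ C)
    (hC : ∀ t : ℝ, 0 ≤ t → ∀ f : V n → ℝ, Sm f →
      ∫ p, |evalT t f (Terms L) p| ≤ C * ((1 + t) ^ 2)⁻¹ * En N t f ^ 2) :
    ∫ p : V n, |DL t1 L (fun p => f t1 p.1 p.2) p| ≤
      (∫ p : V n, |DL 0 L (fun p => f 0 p.1 p.2) p|) + |μ * cn| * C * A ^ 2 := by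
  have hn3 : 3 ≤ n := by omega
  have hGs : ContDiff ℝ ∞ (fun u : U n => f u.1 u.2.1 u.2.2) := hf
  have hg : ∀ t ∈ Set.Icc 0 t1, Sm (fun p : V n => f t p.1 p.2) := fun t ht =>
    ⟨hGs.comp (contDiff_const.prodMk contDiff_id), hc t ht⟩
  have hA0 : 0 ≤ A := (En_nonneg _ _ _).trans (hE 0 ⟨le_rfl, ht1⟩)
  have hsl : ∀ t, (fun p : V n => DUL L (fun u : U n => f u.1 u.2.1 u.2.2) (t, p))
      = DL t L (fun p => f t p.1 p.2) := fun t => by ext p; exact DUL_slice hGs L t p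
  have hsl' : ∀ t p, DUL L (fun u : U n => f u.1 u.2.1 u.2.2) (t, p)
      = DL t L (fun p : V n => f t p.1 p.2) p := fun t p => DUL_slice hGs L t p
  have hDd := (contDiff_DUL hGs L).differentiable (by simp)
  set K : ℝ := |μ * cn| * C * A ^ 2 with hKdef
  have hK0 : 0 ≤ K := by positivity
  have main := L1est (contDiff_DUL hGs L) ht1 (a := fun t => aJ (μ * cn) (fun p => f t p.1 p.2))
    (e := eJ) (M := n * (|μ * cn| * (n * (CK n * (2 * A))))) (A := A)
    (b := fun s => K * ((1 + |s|) ^ 2)⁻¹)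
    (S := fun t p => μ * cn * evalT t (fun p => f t p.1 p.2) (Terms L) p)
    (by have := CK_pos (n := n); positivity)
    (continuous_const.mul (Continuous.inv₀ (by fun_prop) fun s => by positivity))
    (fun t ht => by rw [hsl]; exact (hg t ht).DL t L)
    (fun t ht j => contDiff_aJ hn3 _ (hg t ht) j)
    (fun t ht j p => div_aJ hn3 _ (hg t ht) j p)
    (fun t ht p => aJ_norm hn3 _ (fun p i => by
      have h := grad_bound hn3 (N := N) (by omega) t (hg t ht) p (EuclideanSpace.single i 1, 0)
      refine h.trans ?_
      have h2 := hE t ht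
      have h3 := CK_pos (n := n)
      simp only [EuclideanSpace.norm_single, norm_one, mul_one]
      gcongr) p)
    (fun t ht => ⟨contDiff_const.mul (Sm_evalT hn3 (hg t ht) t _).smooth,
      HasCompactSupport.mul_left (Sm_evalT hn3 (hg t ht) t _).cpt⟩)
    (fun t ht => by
      have h := hC t ht.1 _ (hg t ht)
      simp only [abs_mul (μ * cn), integral_const_mul]
      rw [abs_of_nonneg ht.1, hKdef]
      have h2 := hE t ht
      have h0 := En_nonneg N t (fun p : V n => f t p.1 p.2)
      have h3 : 0 ≤ ((1 + t) ^ 2)⁻¹ := by positivity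
      calc _ ≤ |μ * cn| * (C * ((1 + t) ^ 2)⁻¹ * En N t (fun p : V n => f t p.1 p.2) ^ 2) := by gcongr
        _ ≤ |μ * cn| * (C * ((1 + t) ^ 2)⁻¹ * A ^ 2) := by gcongr
        _ = _ := by ring)
    (fun t ht => by
      simp only [hsl']
      exact (le_En t _ L hL).trans (hE t ht))
    (fun t ht p => by
      have h1 := vlasov_comm hn3 hf (hφ t ht) (hV t ht) (hc t ht) L p
      rw [TT_eq hDd] at h1
      rw [Fintype.sum_sum_type]
      simp only [hsl, hsl', aJ, eJ] at h1 ⊢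
      rw [clm_fst] at h1
      have h4 : ∑ i, μ * cn * fderiv ℝ (Phi fun p : V n => f t p.1 p.2) p (EuclideanSpace.single i 1, 0)
        * fderiv ℝ (DL t L fun p : V n => f t p.1 p.2) p (0, EuclideanSpace.single i 1)
          = μ * cn * B (fun p => f t p.1 p.2) (DL t L (fun p => f t p.1 p.2)) p := by
        unfold B; rw [Finset.mul_sum]
        exact Finset.sum_congr rfl fun i _ => by ring
      rw [h4]
      linarith)
  simp only [hsl'] at main
  exact main.trans (by gcongr; exact int_bound ht1 K hK0)

lemma est_E (hn : 4 ≤ n) {N : ℕ} (hN : 2 * n ≤ N) : ∃ C : ℝ, 0 ≤ C ∧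
    ∀ (μ cn : ℝ) (f : ℝ → E n → E n → ℝ) (φ : ℝ → E n → ℝ)
    (hf : SmoothTXV n f) (t1 A : ℝ) (ht1 : 0 ≤ t1)
    (hφ : ∀ t ∈ Set.Icc 0 t1, ∀ x : E n, φ t x = ∫ y : E n, cn * ‖x - y‖ ^ ((2 : ℝ) - (n : ℝ)) * rho f t y)
    (hV : ∀ t ∈ Set.Icc 0 t1, ∀ x v, Tphi μ φ f t x v = 0)
    (hc : ∀ t ∈ Set.Icc 0 t1, HasCompactSupport (fun p : E n × E n => f t p.1 p.2))
    (hE : ∀ t ∈ Set.Icc 0 t1, En N t (fun p : V n => f t p.1 p.2) ≤ A),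
    En N t1 (fun p : V n => f t1 p.1 p.2) ≤ En N 0 (fun p : V n => f 0 p.1 p.2) + |μ * cn| * C * A ^ 2 := by
  have hex : ∀ L : List (VFIdx n), ∃ C : ℝ, 0 ≤ C ∧ (L.length ≤ N → ∀ t : ℝ, 0 ≤ t → ∀ f : V n → ℝ, Sm f →
      ∫ p, |evalT t f (Terms L) p| ≤ C * ((1 + t) ^ 2)⁻¹ * En N t f ^ 2) := by
    intro L
    by_cases hL : L.length ≤ N
    · obtain ⟨C, h0, h⟩ := evalT_Terms_le hn hN L hL
      exact ⟨C, h0, fun _ => h⟩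
    · exact ⟨0, le_rfl, fun h => absurd h hL⟩
  choose C hC0 hC using hex
  refine ⟨∑ m ∈ Finset.range (N+1), ∑ α : Fin m → VFIdx n, C (List.ofFn α),
    Finset.sum_nonneg fun _ _ => Finset.sum_nonneg fun _ _ => hC0 _, ?_⟩
  intro μ cn f φ hf t1 A ht1 hφ hV hc hE
  unfold En
  simp only [Finset.mul_sum, Finset.sum_mul]
  rw [← Finset.sum_add_distrib]
  refine Finset.sum_le_sum fun m hm => ?_
  rw [← Finset.sum_add_distrib]
  refine Finset.sum_le_sum fun α _ => ?_
  have hL : (List.ofFn α).length ≤ N := by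
    rw [List.length_ofFn]; rw [Finset.mem_range] at hm; omega
  exact est_L hn hN hf ht1 hφ hV hc hE _ hL (hC0 _) (hC _ hL)

/-- abstract continuity argument -/
lemma bootstrap {e : ℝ → ℝ} {T ε : ℝ} (hε : 0 < ε) (hc : ContinuousOn e (Set.Ico 0 T)) (h0 : e 0 ≤ ε)
    (himp : ∀ t1 ∈ Set.Ico 0 T, (∀ t ∈ Set.Icc 0 t1, e t ≤ 2 * ε) → e t1 < 2 * ε) :
    ∀ t ∈ Set.Ico 0 T, e t ≤ 2 * ε := by
  intro t ht
  by_contra! hlt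
  have hsub : Set.Icc 0 t ⊆ Set.Ico 0 T := fun s hs => ⟨hs.1, hs.2.trans_lt ht.2⟩
  have hcl : IsClosed (Set.Icc 0 t ∩ e ⁻¹' Set.Ici (2 * ε)) :=
    (hc.mono hsub).preimage_isClosed_of_isClosed isClosed_Icc isClosed_Ici
  have hne : (Set.Icc 0 t ∩ e ⁻¹' Set.Ici (2 * ε)).Nonempty := ⟨t, ⟨ht.1, le_rfl⟩, hlt.le⟩
  have hbb : BddBelow (Set.Icc 0 t ∩ e ⁻¹' Set.Ici (2 * ε)) := ⟨0, fun s hs => hs.1.1⟩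
  have hmem := hcl.csInf_mem hne hbb
  set s := sInf (Set.Icc 0 t ∩ e ⁻¹' Set.Ici (2 * ε)) with hs
  have hbefore : ∀ r, 0 ≤ r → r < s → e r < 2 * ε := by
    intro r hr hrs
    by_contra! hge
    have : s ≤ r := csInf_le hbb ⟨⟨hr, hrs.le.trans hmem.1.2⟩, hge⟩
    linarith
  have hse : 2 * ε ≤ e s := hmem.2
  have hs0 : 0 < s := by
    rcases hmem.1.1.eq_or_lt with h | h
    · rw [← h] at hse; linarith
    · exact h
  have hcs : ContinuousWithinAt e (Set.Ico 0 s) s :=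
    (hc s (hsub hmem.1)).mono fun r hr => ⟨hr.1, hr.2.trans (hsub hmem.1).2⟩
  have hle : e s ≤ 2 * ε := by
    haveI : (nhdsWithin s (Set.Ico 0 s)).NeBot := by
      rw [← mem_closure_iff_nhdsWithin_neBot, closure_Ico hs0.ne]
      exact ⟨hs0.le, le_rfl⟩
    refine le_of_tendsto hcs.tendsto ?_
    filter_upwards [self_mem_nhdsWithin] with r hr
    exact (hbefore r hr.1 hr.2).le
  have := himp s (hsub hmem.1) (fun r hr => by
    rcases hr.2.eq_or_lt with h | h
    · rw [h]; exact hle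
    · exact (hbefore r hr.1 h).le)
  linarith

end VP

/-- small-data global bound for the Vlasov–Poisson system in
dimension `n ≥ 4`: if `𝓔_N[f(0)] ≤ ε ≤ ε₀` then `𝓔_N[f(t)] ≤ 2ε` on `[0,T)`. -/
theorem vlasov_poisson_high_dimension (n N : ℕ) (hn : 4 ≤ n) (hN : 2 * n ≤ N)
    (μ : ℝ) (hμ : μ = 1 ∨ μ = -1) (cn : ℝ) :
    ∃ ε₀ : ℝ, 0 < ε₀ ∧
      ∀ ε : ℝ, 0 < ε → ε ≤ ε₀ →
      ∀ T : ℝ, ∀ (f : ℝ → E n → E n → ℝ) (φ : ℝ → E n → ℝ),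
        SmoothTXV n f →
        (∀ t ∈ Set.Ico (0 : ℝ) T, ∀ x : E n,
          φ t x = ∫ y : E n, cn * ‖x - y‖ ^ ((2 : ℝ) - (n : ℝ)) * rho f t y) →
        (∀ t ∈ Set.Ico (0 : ℝ) T, ∀ x v, Tphi μ φ f t x v = 0) →
        (∀ t ∈ Set.Ico (0 : ℝ) T,
          HasCompactSupport (fun p : E n × E n => f t p.1 p.2)) →
        ContinuousOn (energy n N f) (Set.Ico (0 : ℝ) T) →
        energy n N f 0 ≤ ε →
        ∀ t ∈ Set.Ico (0 : ℝ) T, energy n N f t ≤ 2 * ε := by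
  obtain ⟨C, hC0, hC⟩ := VP.est_E (n := n) hn hN
  set K : ℝ := |μ * cn| * C with hK
  have hK0 : 0 ≤ K := by positivity
  refine ⟨1 / (8 * (K + 1)), by positivity, ?_⟩
  intro ε hε hε0 T f φ hf hφ hV hc hcont h0
  have hEn : ∀ t ∈ Set.Ico (0 : ℝ) T,
      energy n N f t = VP.En N t (fun p : VP.V n => f t p.1 p.2) := by
    intro t ht
    refine VP.energy_eq N f (fun p : VP.V n => f t p.1 p.2) t (fun x v => rfl) ⟨?_, hc t ht⟩
    have hf' : ContDiff ℝ (⊤ : ℕ∞) (fun p : ℝ × E n × E n => f p.1 p.2.1 p.2.2) := hf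
    exact hf'.comp (contDiff_const.prodMk contDiff_id)
  refine VP.bootstrap hε hcont h0 ?_
  intro t1 ht1 hle
  have hsub : ∀ t ∈ Set.Icc 0 t1, t ∈ Set.Ico 0 T := fun t ht => ⟨ht.1, ht.2.trans_lt ht1.2⟩
  have h00 : (0 : ℝ) ∈ Set.Icc 0 t1 := ⟨le_rfl, ht1.1⟩
  have h := hC μ cn f φ hf t1 (2 * ε) ht1.1 (fun t ht => hφ t (hsub t ht))
    (fun t ht => hV t (hsub t ht)) (fun t ht => hc t (hsub t ht))
    (fun t ht => by rw [← hEn t (hsub t ht)]; exact hle t ht)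
  rw [← hEn t1 ht1, ← hEn 0 (hsub 0 h00), ← hK] at h
  rw [le_div_iff₀ (by positivity)] at hε0
  nlinarith [mul_pos hε hε, mul_nonneg hK0 hε.le]
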